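/- There is an absolute constant C > 0 such that for every ε > 0 there exists n₀ with the following property: for every n ≥ n₀, if Γ is a connected Cayley graph on a finite abelian group F of order 2n with symmetric generating set D (D = −D, 0 ∉ D, D generates F) of size d satisfying (1) d ≥ C · (log d)^8 · (log n), (2) d ≤ n^{1/3}, and (3) |D + D| ≥ d · (log d)^3, then i(Γ) ≤ (1 + ε) · 2^{n+1}. -/

import Mathlib

open Pointwise Real

/-- The number of independent sets of a finite simple graph (including the empty set). -/
noncomputable def numIndSets {V : Type*} [Fintype V] (G : SimpleGraph V) : ℕ :=
  Nat.card {s : Set V // ∀ ⦃u v : V⦄, u ∈ s → v ∈ s → ¬ G.Adj u v}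

/-- The Cayley graph of an abelian group with generator set `D`: `u ~ v` iff `v - u ∈ D`
(for `D` symmetric with `0 ∉ D`). -/
def cayleyGraph {F : Type*} [AddCommGroup F] (D : Set F) : SimpleGraph F :=
  SimpleGraph.fromRel (fun u v => v - u ∈ D)

set_option linter.all false

noncomputable def cutw {G : Type*} [Fintype G] [DecidableEq G] (w : G → G → ℝ) (S : Finset G) : ℝ :=
  ∑ x ∈ S, ∑ y ∈ Sᶜ, w x y

def preS {G V : Type*} [Fintype G] [DecidableEq V] (pr : G → V) (S : Finset V) : Finset G :=
  Finset.univ.filter (fun x => pr x ∈ S)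

lemma preS_compl {G V : Type*} [Fintype G] [DecidableEq G] [Fintype V] [DecidableEq V] (pr : G → V) (S : Finset V) :
    preS pr Sᶜ = (preS pr S)ᶜ := by
  ext x; simp [preS]

/-- total weight between fibres -/
noncomputable def fibW {G V : Type*} [Fintype G] [DecidableEq V] (w : G → G → ℝ) (pr : G → V) (a b : V) : ℝ :=
  ∑ x, ∑ y, if pr x = a ∧ pr y = b then w x y else 0

lemma fibW_nonneg {G V : Type*} [Fintype G] [DecidableEq V] (w : G → G → ℝ) (hw : ∀ x y, 0 ≤ w x y) (pr : G → V) (a b : V) :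
    0 ≤ fibW w pr a b := by
  unfold fibW
  refine Finset.sum_nonneg fun x _ => Finset.sum_nonneg fun y _ => ?_
  split_ifs
  · exact hw x y
  · exact le_rfl

lemma cutw_preS {G V : Type*} [Fintype G] [DecidableEq G] [Fintype V] [DecidableEq V] (w : G → G → ℝ) (pr : G → V)
    (S : Finset V) : cutw w (preS pr S) = ∑ a ∈ S, ∑ b ∈ Sᶜ, fibW w pr a b := by
  unfold cutw fibW
  have h1 : ∀ a ∈ S, ∑ b ∈ Sᶜ, ∑ x, ∑ y, (if pr x = a ∧ pr y = b then w x y else 0)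
      = ∑ x, ∑ y, (if pr x = a ∧ pr y ∈ Sᶜ then w x y else 0) := by
    intro a _
    rw [Finset.sum_comm]
    refine Finset.sum_congr rfl fun x _ => ?_
    rw [Finset.sum_comm]
    refine Finset.sum_congr rfl fun y _ => ?_
    by_cases hx : pr x = a
    · simp [hx]
    · simp [hx]
  rw [Finset.sum_congr rfl h1]
  conv_rhs => rw [Finset.sum_comm]
  rw [← preS_compl]
  unfold preS
  rw [Finset.sum_filter]
  refine Finset.sum_congr rfl fun x _ => ?_
  conv_rhs => rw [Finset.sum_comm]
  rw [Finset.sum_filter]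
  by_cases hx : pr x ∈ S
  · rw [if_pos hx]
    apply Finset.sum_congr rfl
    intro y _
    by_cases hy : pr y ∈ Sᶜ
    · simp only [hy, and_true]; simp [hx]
    · simp only [hy, and_false]; simp
  · rw [if_neg hx]
    symm
    refine Finset.sum_eq_zero fun y _ => Finset.sum_eq_zero fun a ha => ?_
    rw [if_neg]
    rintro ⟨h, _⟩
    exact hx (h ▸ ha)

theorem karger {G : Type*} [Fintype G] [DecidableEq G] (w : G → G → ℝ) (hw : ∀ x y, 0 ≤ w x y)
    (lam : ℝ) (hlam : 0 < lam) (r : ℕ) (hr : 1 ≤ r) :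
    ∀ (m : ℕ) (V : Type) [Fintype V] [DecidableEq V] (pr : G → V), Fintype.card V = m →
      (∀ S : Finset V, S.Nonempty → S ≠ Finset.univ → lam ≤ cutw w (preS pr S)) → r ≤ m →
      (Finset.univ.filter (fun S : Finset V => cutw w (preS pr S) + cutw w (preS pr Sᶜ) ≤ r * lam)).card
        ≤ 2 ^ r * m.choose r := by
  intro m
  induction m with
  | zero => intro V _ _ pr hV hS hrm; omega
  | succ m ih =>
    intro V _ _ pr hV hS hrm
    rcases Nat.eq_or_lt_of_le hrm with hrm' | hrm'
    · rw [← hrm', Nat.choose_self, mul_one]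
      refine (Finset.card_filter_le _ _).trans ?_
      rw [Finset.card_univ, Fintype.card_finset, hV, hrm']
    have hrm2 : r ≤ m := by omega
    set good := (Finset.univ.filter (fun S : Finset V => cutw w (preS pr S) + cutw w (preS pr Sᶜ) ≤ r * lam)) with hgood
    -- contraction bound
    have hcon : ∀ a b : V, a ≠ b → (good.filter (fun S => (a ∈ S ↔ b ∈ S))).card ≤ 2 ^ r * m.choose r := by
      intro a b hab
      let V' := {v : V // v ≠ b}
      let ρ : V → V' := fun v => if h : v = b then ⟨a, hab⟩ else ⟨v, h⟩
      have hρs : Function.Surjective ρ := by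
        intro v
        refine ⟨v.1, ?_⟩
        simp only [ρ]
        rw [dif_neg v.2]
      have hρb : ρ b = ρ a := by simp [ρ, hab]
      have hρinj : ∀ u v, ρ u = ρ v → u = v ∨ (u = a ∧ v = b) ∨ (u = b ∧ v = a) := by
        intro u v h
        simp only [ρ] at h
        split_ifs at h with h1 h2 h2
        · left; rw [h1, h2]
        · right; right; exact ⟨h1, (congrArg Subtype.val h).symm⟩
        · right; left; exact ⟨congrArg Subtype.val h, h2⟩
        · left; exact congrArg Subtype.val h
      have hpre : ∀ S' : Finset V', preS (ρ ∘ pr) S' = preS pr (Finset.univ.filter (fun v => ρ v ∈ S')) := by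
        intro S'; ext x; simp [preS]
      have hcV : Fintype.card V' = m := by
        have : Fintype.card V' = Fintype.card V - 1 := by
          simp only [V']
          rw [Fintype.card_subtype_compl (fun v => v = b)]
          simp
        rw [this, hV]; rfl
      have := ih V' (ρ ∘ pr) hcV (by
        intro S' hne hnu
        rw [hpre]
        apply hS
        · obtain ⟨v, hv⟩ := hne
          obtain ⟨u, hu⟩ := hρs v
          exact ⟨u, by simp [hu, hv]⟩
        · intro h
          apply hnu
          ext v
          obtain ⟨u, hu⟩ := hρs v
          have : u ∈ (Finset.univ : Finset V) := Finset.mem_univ u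
          rw [← h] at this
          simp [hu] at this
          simp [this]) hrm2
      refine le_trans ?_ this
      apply Finset.card_le_card_of_surjOn (fun S' : Finset V' => Finset.univ.filter (fun v => ρ v ∈ S'))
      intro S hSm
      simp only [Finset.coe_filter, hgood, Finset.mem_filter, Finset.mem_univ, true_and, Set.mem_setOf_eq] at hSm
      have hSS : Finset.univ.filter (fun v => ρ v ∈ S.image ρ) = S := by
        ext v
        simp only [Finset.mem_filter, Finset.mem_univ, true_and, Finset.mem_image]
        constructor
        · rintro ⟨u, hu, huv⟩
          rcases hρinj u v huv with h | ⟨h1, h2⟩ | ⟨h1, h2⟩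
          · exact h ▸ hu
          · rw [h2]; exact hSm.2.1 (h1 ▸ hu)
          · rw [h2]; exact hSm.2.2 (h1 ▸ hu)
        · intro h; exact ⟨v, h, rfl⟩
      refine ⟨S.image ρ, ?_, hSS⟩
      simp only [Finset.coe_filter, Finset.mem_univ, true_and, Set.mem_setOf_eq]
      rw [preS_compl, hpre, hSS, ← preS_compl]
      exact hSm.1
    set P := (Finset.univ : Finset (V × V)).filter (fun p => p.1 ≠ p.2) with hP
    set Wt := ∑ p ∈ P, fibW w pr p.1 p.2 with hWt
    have hWge : ((m : ℝ) + 1) * lam ≤ Wt := by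
      have h1 : Wt = ∑ a : V, cutw w (preS pr {a}) := by
        rw [hWt, hP, Finset.sum_filter, Fintype.sum_prod_type]
        refine Finset.sum_congr rfl fun a _ => ?_
        rw [cutw_preS]
        rw [Finset.sum_singleton, ← Finset.sum_filter]
        refine Finset.sum_congr ?_ fun _ _ => rfl
        ext b; simp [eq_comm]
      rw [h1]
      have : ∑ a : V, lam ≤ ∑ a : V, cutw w (preS pr {a}) := by
        refine Finset.sum_le_sum fun a _ => hS _ (Finset.singleton_nonempty a) ?_
        intro h
        have := congrArg Finset.card h
        rw [Finset.card_singleton, Finset.card_univ, hV] at this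
        omega
      rw [Finset.sum_const, Finset.card_univ, hV, nsmul_eq_mul] at this
      push_cast at this
      exact this
    have hsep : ∀ S ∈ good, ∑ p ∈ P, (if (p.1 ∈ S ↔ p.2 ∈ S) then fibW w pr p.1 p.2 else 0) ≥ Wt - r * lam := by
      intro S hSg
      have hg := (Finset.mem_filter.1 hSg).2
      rw [cutw_preS, cutw_preS, compl_compl] at hg
      have : Wt - ∑ p ∈ P, (if (p.1 ∈ S ↔ p.2 ∈ S) then fibW w pr p.1 p.2 else 0)
          = ∑ a ∈ S, ∑ b ∈ Sᶜ, fibW w pr a b + ∑ a ∈ Sᶜ, ∑ b ∈ S, fibW w pr a b := by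
        rw [hWt, ← Finset.sum_sub_distrib, hP, Finset.sum_filter, Fintype.sum_prod_type]
        have e : ∀ T U : Finset V, ∑ a ∈ T, ∑ b ∈ U, fibW w pr a b
          = ∑ a, ∑ b, if a ∈ T ∧ b ∈ U then fibW w pr a b else 0 := by
          intro T U
          rw [← Finset.sum_filter_add_sum_filter_not Finset.univ (fun a => a ∈ T)]
          have z : ∑ a ∈ Finset.univ.filter (fun a => ¬ a ∈ T), ∑ b, (if a ∈ T ∧ b ∈ U then fibW w pr a b else 0) = 0 := by
            refine Finset.sum_eq_zero fun a ha => Finset.sum_eq_zero fun b _ => ?_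
            have := (Finset.mem_filter.1 ha).2
            simp [this]
          rw [z, add_zero]
          have : Finset.univ.filter (fun a => a ∈ T) = T := by ext; simp
          rw [this]
          refine Finset.sum_congr rfl fun a ha => ?_
          simp [ha, Finset.sum_ite_mem]
        rw [e, e, ← Finset.sum_add_distrib]
        refine Finset.sum_congr rfl fun a _ => ?_
        rw [← Finset.sum_add_distrib]
        refine Finset.sum_congr rfl fun b _ => ?_
        by_cases ha : a ∈ S <;> by_cases hb : b ∈ S
        · simp [ha, hb]
        · have : a ≠ b := fun h => hb (h ▸ ha)
          simp [ha, hb, this]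
        · have : a ≠ b := fun h => ha (h ▸ hb)
          simp [ha, hb, this]
        · simp [ha, hb]
      linarith
    have hdc : (good.card : ℝ) * (Wt - r * lam) ≤ Wt * (2 ^ r * m.choose r : ℕ) := by
      calc (good.card : ℝ) * (Wt - r * lam) = ∑ S ∈ good, (Wt - r * lam) := by
            rw [Finset.sum_const, nsmul_eq_mul]
        _ ≤ ∑ S ∈ good, ∑ p ∈ P, (if (p.1 ∈ S ↔ p.2 ∈ S) then fibW w pr p.1 p.2 else 0) :=
            Finset.sum_le_sum fun S hs => hsep S hs
        _ = ∑ p ∈ P, ∑ S ∈ good, (if (p.1 ∈ S ↔ p.2 ∈ S) then fibW w pr p.1 p.2 else 0) := Finset.sum_comm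
        _ ≤ ∑ p ∈ P, fibW w pr p.1 p.2 * (2 ^ r * m.choose r : ℕ) := by
            refine Finset.sum_le_sum fun p hp => ?_
            rw [← Finset.sum_filter, Finset.sum_const, nsmul_eq_mul, mul_comm]
            refine mul_le_mul_of_nonneg_left ?_ (fibW_nonneg w hw pr _ _)
            exact_mod_cast hcon p.1 p.2 (Finset.mem_filter.1 hp).2
        _ = _ := by rw [← Finset.sum_mul]
    have hWpos : 0 < Wt := lt_of_lt_of_le (by positivity) hWge
    have h3 : (good.card : ℝ) * ((m + 1 : ℝ) - r) ≤ (m + 1) * (2 ^ r * m.choose r : ℕ) := by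
      have h4 : Wt * ((m + 1 : ℝ) - r) ≤ (m + 1) * (Wt - r * lam) := by
        have : (r : ℝ) * ((m + 1) * lam) ≤ r * Wt := mul_le_mul_of_nonneg_left hWge (by positivity)
        nlinarith
      have h5 : (good.card : ℝ) * (Wt * ((m + 1 : ℝ) - r)) ≤ good.card * ((m + 1) * (Wt - r * lam)) :=
        mul_le_mul_of_nonneg_left h4 (by positivity)
      have h6 : (m + 1 : ℝ) * ((good.card : ℝ) * (Wt - r * lam)) ≤ (m + 1) * (Wt * (2 ^ r * m.choose r : ℕ)) :=
        mul_le_mul_of_nonneg_left hdc (by positivity)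
      have h7 : Wt * ((good.card : ℝ) * ((m + 1 : ℝ) - r)) ≤ Wt * ((m + 1) * (2 ^ r * m.choose r : ℕ)) := by
        nlinarith
      exact le_of_mul_le_mul_left h7 hWpos
    have h8 : good.card * (m + 1 - r) ≤ (m + 1) * (2 ^ r * m.choose r) := by
      have : ((m + 1 - r : ℕ) : ℝ) = (m + 1 : ℝ) - r := by
        rw [Nat.cast_sub hrm]; push_cast; ring
      rw [← this] at h3
      exact_mod_cast h3
    have h9 := Nat.choose_mul_succ_eq m r
    have h10 : good.card * (m + 1 - r) ≤ (2 ^ r * (m+1).choose r) * (m + 1 - r) := by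
      calc _ ≤ _ := h8
        _ = 2 ^ r * (m.choose r * (m + 1)) := by ring
        _ = _ := by rw [h9]; ring
    exact Nat.le_of_mul_le_mul_right h10 (by omega)

theorem karger' {G : Type*} [Fintype G] [DecidableEq G] (w : G → G → ℝ) (hw : ∀ x y, 0 ≤ w x y)
    (lam : ℝ) (hlam : 0 < lam) (r : ℕ) (hr : 1 ≤ r) (V : Type) [Fintype V] [DecidableEq V] (pr : G → V)
    (n : ℕ) (hn : 1 ≤ n) (hV : Fintype.card V ≤ n)
    (hS : ∀ S : Finset V, S.Nonempty → S ≠ Finset.univ → lam ≤ cutw w (preS pr S)) :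
      (Finset.univ.filter (fun S : Finset V => cutw w (preS pr S) + cutw w (preS pr Sᶜ) ≤ r * lam)).card
        ≤ (2 * n) ^ r := by
  rcases le_total r (Fintype.card V) with h | h
  · refine (karger w hw lam hlam r hr _ V pr rfl hS h).trans ?_
    rw [mul_pow]
    exact Nat.mul_le_mul_left _ ((Nat.choose_le_pow _ _).trans (Nat.pow_le_pow_left hV _))
  · refine (Finset.card_filter_le _ _).trans ?_
    rw [Finset.card_univ, Fintype.card_finset]
    calc 2 ^ Fintype.card V ≤ 2 ^ r := Nat.pow_le_pow_right (by norm_num) h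
      _ ≤ _ := Nat.pow_le_pow_left (by omega) r

lemma greedy_cover {α β : Type*} [DecidableEq α] [DecidableEq β] (A : Finset α) (f : α → Finset β) (T : Finset β)
    (hT : ∀ x ∈ A, f x ⊆ T) (ψ : ℕ) :
    ∃ X ⊆ A, X.card * ψ ≤ T.card ∧ ∀ x ∈ A, (f x \ X.biUnion f).card ≤ ψ := by
  classical
  have hne : (A.powerset.filter (fun X => X.card * ψ ≤ (X.biUnion f).card)).Nonempty :=
    ⟨∅, by simp⟩
  obtain ⟨X, hX, hmax⟩ := Finset.exists_max_image _ Finset.card hne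
  rw [Finset.mem_filter, Finset.mem_powerset] at hX
  refine ⟨X, hX.1, hX.2.trans (Finset.card_le_card ?_), ?_⟩
  · intro y hy
    rw [Finset.mem_biUnion] at hy
    obtain ⟨x, hx, hy⟩ := hy
    exact hT x (hX.1 hx) hy
  · intro x hx
    by_contra hcon
    push Not at hcon
    have hxX : x ∉ X := by
      intro hxX
      have : f x \ X.biUnion f = ∅ := by
        rw [Finset.sdiff_eq_empty_iff_subset]
        exact Finset.subset_biUnion_of_mem f hxX
      rw [this] at hcon
      simp at hcon
    have h1 : ((insert x X).biUnion f).card = (f x \ X.biUnion f).card + (X.biUnion f).card := by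
      rw [Finset.biUnion_insert, ← Finset.card_sdiff_add_card (f x) (X.biUnion f)]
    have h2 : insert x X ∈ A.powerset.filter (fun X => X.card * ψ ≤ (X.biUnion f).card) := by
      rw [Finset.mem_filter, Finset.mem_powerset]
      refine ⟨Finset.insert_subset hx hX.1, ?_⟩
      rw [h1, Finset.card_insert_of_notMem hxX, add_mul]
      have := hX.2
      omega
    have := hmax _ h2
    rw [Finset.card_insert_of_notMem hxX] at this
    omega

section cont
variable {X Y : Type*} [Fintype X] [Fintype Y] [DecidableEq X] [DecidableEq Y]

def nbr (out : X → Finset Y) (A : Finset X) : Finset Y := A.biUnion out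

def clo (out : X → Finset Y) (A : Finset X) : Finset X := Finset.univ.filter (fun x => out x ⊆ nbr out A)

lemma subset_clo (out : X → Finset Y) (A : Finset X) : A ⊆ clo out A := by
  intro x hx
  simp only [clo, Finset.mem_filter, Finset.mem_univ, true_and]
  exact Finset.subset_biUnion_of_mem out hx

lemma nbr_clo (out : X → Finset Y) (A : Finset X) : nbr out (clo out A) = nbr out A := by
  apply le_antisymm
  · intro y hy
    simp only [nbr, Finset.mem_biUnion] at hy
    obtain ⟨x, hx, hy⟩ := hy
    simp only [clo, Finset.mem_filter] at hx
    exact hx.2 hy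
  · exact Finset.biUnion_subset_biUnion_of_subset_left _ (subset_clo out A)

lemma edge_count (out : X → Finset Y) (inn : Y → Finset X) (hio : ∀ x y, x ∈ inn y ↔ y ∈ out x)
    (A : Finset X) (B : Finset Y) : ∑ x ∈ A, (out x ∩ B).card = ∑ y ∈ B, (inn y ∩ A).card := by
  have := Finset.sum_card_bipartiteAbove_eq_sum_card_bipartiteBelow (s := A) (t := B) (fun x y => y ∈ out x)
  convert this using 2 with x hx y hy
  · congr 1; ext y; simp [Finset.bipartiteAbove, and_comm]
  · congr 1; ext x; simp [Finset.bipartiteBelow, and_comm, hio]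

lemma edge_out (out : X → Finset Y) (inn : Y → Finset X) (hio : ∀ x y, x ∈ inn y ↔ y ∈ out x)
    (d : ℕ) (ho : ∀ x, (out x).card = d) (hi : ∀ y, (inn y).card = d) (A : Finset X) (t : ℕ)
    (hA : (nbr out A).card = A.card + t) :
    ∑ y ∈ nbr out A, (inn y \ A).card = d * t := by
  have h1 : ∑ y ∈ nbr out A, (inn y ∩ A).card = d * A.card := by
    rw [← edge_count out inn hio]
    rw [Finset.sum_congr rfl (g := fun _ => d)]
    · simp [mul_comm]
    · intro x hx
      have hs : out x ⊆ nbr out A := Finset.subset_biUnion_of_mem out hx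
      rw [Finset.inter_eq_left.2 hs, ho]
  have h2 : ∑ y ∈ nbr out A, (inn y \ A).card + ∑ y ∈ nbr out A, (inn y ∩ A).card = d * (nbr out A).card := by
    rw [← Finset.sum_add_distrib, Finset.sum_congr rfl (g := fun _ => d)]
    · simp [mul_comm]
    · intro y _
      rw [Finset.card_sdiff_add_card_inter, hi]
  rw [hA, h1] at h2
  linarith

structure GoodC (out : X → Finset Y) (inn : Y → Finset X) (A S : Finset X) (M : Finset Y) (t ψ : ℕ) : Prop where
  sub : A ⊆ S
  subM : M ⊆ nbr out A
  c1 : (S \ A).card ≤ 6 * t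
  c2 : (nbr out A \ M).card ≤ 2 * t
  p1 : ∀ x ∈ S, (out x \ M).card ≤ ψ
  p2 : ∀ y, y ∉ M → (inn y ∩ S).card ≤ ψ

def cS1 (out : X → Finset Y) (ψ : ℕ) (F0 : Finset Y) (X1 : Finset X) : Finset X :=
  Finset.univ.filter (fun x => (out x \ (F0 ∪ nbr out X1)).card ≤ ψ)
def cS2 (out : X → Finset Y) (inn : Y → Finset X) (ψ : ℕ) (F0 : Finset Y) (X1 : Finset X) (Y1 : Finset Y) : Finset X :=
  cS1 out ψ F0 X1 \ Y1.biUnion inn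
def cM1 (out : X → Finset Y) (inn : Y → Finset X) (ψ : ℕ) (F0 : Finset Y) (X1 : Finset X) (Y1 : Finset Y) : Finset Y :=
  Finset.univ.filter (fun y => ψ < (inn y ∩ cS2 out inn ψ F0 X1 Y1).card)
def cM (out : X → Finset Y) (inn : Y → Finset X) (ψ : ℕ) (F0 : Finset Y) (X1 : Finset X) (Y1 : Finset Y) (X2 : Finset X) :
    Finset Y := cM1 out inn ψ F0 X1 Y1 ∪ nbr out X2
def cS (out : X → Finset Y) (inn : Y → Finset X) (ψ : ℕ) (F0 : Finset Y) (X1 : Finset X) (Y1 : Finset Y) (X2 : Finset X) :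
    Finset X := (cS2 out inn ψ F0 X1 Y1).filter (fun x => (out x \ cM out inn ψ F0 X1 Y1 X2).card ≤ ψ)

lemma nbr_mono (out : X → Finset Y) {A B : Finset X} (h : A ⊆ B) : nbr out A ⊆ nbr out B :=
  Finset.biUnion_subset_biUnion_of_subset_left _ h

theorem container (out : X → Finset Y) (inn : Y → Finset X) (hio : ∀ x y, x ∈ inn y ↔ y ∈ out x)
    (d : ℕ) (ho : ∀ x, (out x).card = d) (hi : ∀ y, (inn y).card = d) (A : Finset X) (t ψ : ℕ) (hd : 0 < d)
    (hψ : 2 * ψ ≤ d) (hA : (nbr out A).card = A.card + t) (F0 : Finset Y)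
    (h1 : (nbr out A \ F0).card ≤ 3 * t) (h2 : (F0 \ nbr out A).card ≤ 2 * t) :
    ∃ (X1 : Finset X) (Y1 : Finset Y) (X2 : Finset X), X1.card * ψ ≤ 6 * t ∧ Y1.card * ψ ≤ 6 * t ∧
      X2.card * ψ ≤ 6 * t ∧ GoodC out inn A (cS out inn ψ F0 X1 Y1 X2) (cM out inn ψ F0 X1 Y1 X2) t ψ := by
  have houtN : ∀ x ∈ A, out x ⊆ nbr out A := fun x hx => Finset.subset_biUnion_of_mem out hx
  have hbu : ∀ (Z : Finset X) (F : Finset Y), Z.biUnion (fun x => out x \ F) ⊆ nbr out Z := by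
    intro Z F y hy
    simp only [Finset.mem_biUnion, Finset.mem_sdiff, nbr] at hy ⊢
    obtain ⟨x, hx, hy, _⟩ := hy
    exact ⟨x, hx, hy⟩
  have hgen : ∀ (Z : Finset X) (F : Finset Y) (x : X), out x \ (F ∪ nbr out Z) ⊆ (out x \ F) \ Z.biUnion (fun x => out x \ F) := by
    intro Z F x y hy
    simp only [Finset.mem_sdiff, Finset.mem_union, not_or] at hy ⊢
    exact ⟨⟨hy.1, hy.2.1⟩, fun h => hy.2.2 (hbu Z F h)⟩
  obtain ⟨X1, hX1A, hX1c, hX1⟩ := greedy_cover A (fun x => out x \ F0) (nbr out A \ F0)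
    (fun x hx => Finset.sdiff_subset_sdiff (houtN x hx) le_rfl) ψ
  set S1 := cS1 out ψ F0 X1 with hS1
  have hAS1 : A ⊆ S1 := by
    intro x hx
    simp only [hS1, cS1, Finset.mem_filter, Finset.mem_univ, true_and]
    exact (Finset.card_le_card (hgen X1 F0 x)).trans (hX1 x hx)
  have hS1A : (S1 \ A).card ≤ 6 * t := by
    set F1 := F0 ∪ nbr out X1 with hF1
    have e1 : (S1 \ A).card * (d - ψ) ≤ ∑ x ∈ S1 \ A, (out x ∩ F1).card := by
      rw [← smul_eq_mul]
      apply Finset.card_nsmul_le_sum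
      intro x hx
      have hx1 := (Finset.mem_sdiff.1 hx).1
      simp only [hS1, cS1, Finset.mem_filter, Finset.mem_univ, true_and, ← hF1] at hx1
      have := Finset.card_sdiff_add_card_inter (out x) F1
      rw [ho] at this
      omega
    have e2 : ∑ x ∈ S1 \ A, (out x ∩ F1).card ≤ d * t + d * (2 * t) := by
      rw [edge_count out inn hio]
      have hF1s : F1 ⊆ nbr out A ∪ (F0 \ nbr out A) := by
        intro y hy
        rw [hF1, Finset.mem_union] at hy
        rw [Finset.mem_union, Finset.mem_sdiff]
        rcases hy with hy | hy
        · by_cases h : y ∈ nbr out A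
          · exact Or.inl h
          · exact Or.inr ⟨hy, h⟩
        · exact Or.inl (nbr_mono out hX1A hy)
      calc ∑ y ∈ F1, (inn y ∩ (S1 \ A)).card
          ≤ ∑ y ∈ nbr out A ∪ (F0 \ nbr out A), (inn y ∩ (S1 \ A)).card :=
            Finset.sum_le_sum_of_subset hF1s
        _ = ∑ y ∈ nbr out A, (inn y ∩ (S1 \ A)).card + ∑ y ∈ F0 \ nbr out A, (inn y ∩ (S1 \ A)).card :=
            Finset.sum_union Finset.disjoint_sdiff
        _ ≤ ∑ y ∈ nbr out A, (inn y \ A).card + ∑ y ∈ F0 \ nbr out A, d := by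
            refine add_le_add (Finset.sum_le_sum fun y _ => Finset.card_le_card ?_)
              (Finset.sum_le_sum fun y _ => ?_)
            · intro x hx
              simp only [Finset.mem_inter, Finset.mem_sdiff] at hx ⊢
              exact ⟨hx.1, hx.2.2⟩
            · rw [← hi y]; exact Finset.card_le_card Finset.inter_subset_left
        _ ≤ d * t + d * (2 * t) := by
            rw [edge_out out inn hio d ho hi A t hA, Finset.sum_const, smul_eq_mul, mul_comm _ d]
            exact Nat.add_le_add_left (Nat.mul_le_mul_left _ h2) _
    have e3 : (S1 \ A).card * d ≤ (6 * t) * d := by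
      have : d ≤ 2 * (d - ψ) := by omega
      calc (S1 \ A).card * d ≤ (S1 \ A).card * (2 * (d - ψ)) := Nat.mul_le_mul_left _ this
        _ = 2 * ((S1 \ A).card * (d - ψ)) := by ring
        _ ≤ 2 * (d * t + d * (2 * t)) := Nat.mul_le_mul_left _ (e1.trans e2)
        _ = _ := by ring
    exact Nat.le_of_mul_le_mul_right e3 hd
  have hinA : ∀ y, y ∉ nbr out A → ∀ x ∈ inn y, x ∉ A := by
    intro y hy x hx hxA
    exact hy (houtN x hxA ((hio x y).1 hx))
  obtain ⟨Y1, hY1A, hY1c, hY1⟩ := greedy_cover (nbr out A)ᶜ (fun y => inn y ∩ S1) (S1 \ A)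
    (by
      intro y hy x hx
      rw [Finset.mem_compl] at hy
      simp only [Finset.mem_inter] at hx
      exact Finset.mem_sdiff.2 ⟨hx.2, hinA y hy x hx.1⟩) ψ
  set S2 := cS2 out inn ψ F0 X1 Y1 with hS2
  have hS2S1 : S2 ⊆ S1 := Finset.sdiff_subset
  have hAS2 : A ⊆ S2 := by
    intro x hx
    simp only [hS2, cS2, Finset.mem_sdiff, Finset.mem_biUnion, not_exists, not_and]
    exact ⟨hAS1 hx, fun y hy hxy => hinA y (Finset.mem_compl.1 (hY1A hy)) x hxy hx⟩
  set M1 := cM1 out inn ψ F0 X1 Y1 with hM1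
  have hM1N : M1 ⊆ nbr out A := by
    intro y hy
    by_contra hyN
    simp only [hM1, cM1, Finset.mem_filter, Finset.mem_univ, true_and] at hy
    have := hY1 y (Finset.mem_compl.2 hyN)
    have h3 : inn y ∩ cS2 out inn ψ F0 X1 Y1 ⊆ (inn y ∩ S1) \ Y1.biUnion (fun y => inn y ∩ S1) := by
      intro x hx
      simp only [cS2, Finset.mem_inter, Finset.mem_sdiff, Finset.mem_biUnion, not_exists, not_and] at hx ⊢
      refine ⟨⟨hx.1, hx.2.1⟩, fun z hz hxz => absurd hxz (hx.2.2 z hz)⟩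
    have := Finset.card_le_card h3
    omega
  have hNM1 : (nbr out A \ M1).card ≤ 2 * t := by
    have e1 : (nbr out A \ M1).card * (d - ψ) ≤ ∑ y ∈ nbr out A \ M1, (inn y \ A).card := by
      rw [← smul_eq_mul]
      apply Finset.card_nsmul_le_sum
      intro y hy
      have hy1 := (Finset.mem_sdiff.1 hy).2
      simp only [hM1, cM1, Finset.mem_filter, Finset.mem_univ, true_and, not_lt] at hy1
      have h3 : (inn y ∩ A).card ≤ ψ :=
        (Finset.card_le_card (Finset.inter_subset_inter_left hAS2)).trans hy1
      have := Finset.card_sdiff_add_card_inter (inn y) A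
      rw [hi] at this
      omega
    have e2 : ∑ y ∈ nbr out A \ M1, (inn y \ A).card ≤ d * t := by
      rw [← edge_out out inn hio d ho hi A t hA]
      exact Finset.sum_le_sum_of_subset Finset.sdiff_subset
    have e3 : (nbr out A \ M1).card * d ≤ (2 * t) * d := by
      have : d ≤ 2 * (d - ψ) := by omega
      calc (nbr out A \ M1).card * d ≤ (nbr out A \ M1).card * (2 * (d - ψ)) := Nat.mul_le_mul_left _ this
        _ = 2 * ((nbr out A \ M1).card * (d - ψ)) := by ring
        _ ≤ 2 * (d * t) := Nat.mul_le_mul_left _ (e1.trans e2)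
        _ = _ := by ring
    exact Nat.le_of_mul_le_mul_right e3 hd
  obtain ⟨X2, hX2A, hX2c, hX2⟩ := greedy_cover A (fun x => out x \ M1) (nbr out A \ M1)
    (fun x hx => Finset.sdiff_subset_sdiff (houtN x hx) le_rfl) ψ
  refine ⟨X1, Y1, X2, by omega, by omega, by omega, ?_⟩
  constructor
  · intro x hx
    simp only [cS, Finset.mem_filter]
    exact ⟨hAS2 hx, (Finset.card_le_card (hgen X2 M1 x)).trans (hX2 x hx)⟩
  · exact Finset.union_subset hM1N (nbr_mono out hX2A)
  · refine (Finset.card_le_card (Finset.sdiff_subset_sdiff ?_ le_rfl)).trans hS1A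
    exact (Finset.filter_subset _ _).trans hS2S1
  · refine (Finset.card_le_card (Finset.sdiff_subset_sdiff le_rfl ?_)).trans hNM1
    exact Finset.subset_union_left
  · intro x hx
    exact (Finset.mem_filter.1 hx).2
  · intro y hy
    have hy1 : y ∉ M1 := fun h => hy (Finset.mem_union_left _ h)
    simp only [hM1, cM1, Finset.mem_filter, Finset.mem_univ, true_and, not_lt] at hy1
    exact (Finset.card_le_card (Finset.inter_subset_inter_left (Finset.filter_subset _ _))).trans hy1

lemma goodC_edge (out : X → Finset Y) (inn : Y → Finset X) (hio : ∀ x y, x ∈ inn y ↔ y ∈ out x)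
    (A S : Finset X) (M : Finset Y) (t ψ : ℕ) (h : GoodC out inn A S M t ψ) :
    ∑ x ∈ S, (out x \ M).card ≤ 8 * ψ * t := by
  rw [← Finset.sum_sdiff h.sub]
  have e1 : ∑ x ∈ S \ A, (out x \ M).card ≤ (6 * t) * ψ := by
    refine (Finset.sum_le_card_nsmul _ _ ψ fun x hx => h.p1 x (Finset.sdiff_subset hx)).trans ?_
    rw [smul_eq_mul]
    exact Nat.mul_le_mul_right _ h.c1
  have e2 : ∑ x ∈ A, (out x \ M).card ≤ (2 * t) * ψ := by
    have : ∑ x ∈ A, (out x \ M).card = ∑ x ∈ A, (out x ∩ (nbr out A \ M)).card := by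
      refine Finset.sum_congr rfl fun x hx => ?_
      congr 1
      ext y
      simp only [Finset.mem_sdiff, Finset.mem_inter]
      constructor
      · rintro ⟨a, b⟩; exact ⟨a, Finset.subset_biUnion_of_mem out hx a, b⟩
      · rintro ⟨a, b, c⟩; exact ⟨a, c⟩
    rw [this, edge_count out inn hio]
    refine (Finset.sum_le_card_nsmul _ _ ψ fun y hy => ?_).trans ?_
    · exact (Finset.card_le_card (Finset.inter_subset_inter_left h.sub)).trans
        (h.p2 y (Finset.mem_sdiff.1 hy).2)
    · rw [smul_eq_mul]
      exact Nat.mul_le_mul_right _ h.c2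
  calc _ ≤ (6 * t) * ψ + (2 * t) * ψ := add_le_add e1 e2
    _ = _ := by ring

lemma goodC_card (out : X → Finset Y) (inn : Y → Finset X) (hio : ∀ x y, x ∈ inn y ↔ y ∈ out x)
    (d : ℕ) (ho : ∀ x, (out x).card = d) (hi : ∀ y, (inn y).card = d)
    (A S : Finset X) (M : Finset Y) (t ψ : ℕ) (h : GoodC out inn A S M t ψ) :
    d * S.card ≤ d * M.card + 8 * ψ * t := by
  have e1 := goodC_edge out inn hio A S M t ψ h
  have e2 : ∑ x ∈ S, (out x \ M).card + ∑ x ∈ S, (out x ∩ M).card = d * S.card := by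
    rw [← Finset.sum_add_distrib, Finset.sum_congr rfl (g := fun _ => d)]
    · simp [mul_comm]
    · intro y _
      rw [Finset.card_sdiff_add_card_inter, ho]
  have e3 : ∑ x ∈ S, (out x ∩ M).card ≤ d * M.card := by
    rw [edge_count out inn hio]
    refine (Finset.sum_le_card_nsmul _ _ d fun y hy => ?_).trans ?_
    · rw [← hi y]; exact Finset.card_le_card Finset.inter_subset_left
    · rw [smul_eq_mul, mul_comm]
  omega

lemma goodC_nbr (out : X → Finset Y) (inn : Y → Finset X) (hio : ∀ x y, x ∈ inn y ↔ y ∈ out x)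
    (A S : Finset X) (M : Finset Y) (t ψ : ℕ) (h : GoodC out inn A S M t ψ) :
    (nbr out S \ M).card ≤ 8 * ψ * t := by
  refine le_trans ?_ (goodC_edge out inn hio A S M t ψ h)
  have : nbr out S \ M = S.biUnion (fun x => out x \ M) := by
    ext y; simp only [nbr, Finset.mem_sdiff, Finset.mem_biUnion]
    constructor
    · rintro ⟨⟨x, a, b⟩, c⟩; exact ⟨x, a, b, c⟩
    · rintro ⟨x, a, b, c⟩; exact ⟨⟨x, a, b⟩, c⟩
  rw [this]
  exact Finset.card_biUnion_le

/-- number of subsets of size at most q -/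
lemma small_subsets {α : Type*} [DecidableEq α] (R : Finset α) (q : ℕ) (z : ℝ) (hz : 0 < z) (hz1 : z ≤ 1) :
    ((R.powerset.filter (fun T => T.card ≤ q)).card : ℝ) * z ^ q ≤ (1 + z) ^ R.card := by
  have h1 : ∑ T ∈ R.powerset, z ^ T.card = (1 + z) ^ R.card := by
    have := Finset.sum_pow_mul_eq_add_pow z 1 R
    simp only [one_pow, mul_one] at this
    rw [this, add_comm]
  rw [← h1, ← nsmul_eq_mul, ← Finset.sum_const]
  calc ∑ T ∈ R.powerset.filter (fun T => T.card ≤ q), z ^ q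
      ≤ ∑ T ∈ R.powerset.filter (fun T => T.card ≤ q), z ^ T.card := by
        refine Finset.sum_le_sum fun T hT => ?_
        exact pow_le_pow_of_le_one hz.le hz1 (Finset.mem_filter.1 hT).2
    _ ≤ _ := Finset.sum_le_sum_of_subset_of_nonneg (Finset.filter_subset _ _) (fun _ _ _ => by positivity)

open Classical in
/-- final count for one container -/
theorem count_container (out : X → Finset Y) (inn : Y → Finset X) (hio : ∀ x y, x ∈ inn y ↔ y ∈ out x)
    (d : ℕ) (ho : ∀ x, (out x).card = d) (hi : ∀ y, (inn y).card = d) (hd : 0 < d)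
    (S : Finset X) (M : Finset Y) (t ψ g q : ℕ) (ρ z : ℝ) (hz : 0 < z) (hz1 : z ≤ 1)
    (hc1 : (8 * ψ * t : ℝ) / d + ρ * t ≤ q)
    (hc2 : (1 + z) ^ (8 * ψ * t) ≤ z ^ q * (2 : ℝ) ^ ((1 - ρ) * t)) :
    ((Finset.univ.filter (fun P : Finset X => GoodC out inn (clo out P) S M t ψ ∧
      (nbr out P).card = g ∧ (nbr out P).card = (clo out P).card + t)).card : ℝ)
      ≤ (2 : ℝ) ^ (g - ρ * t : ℝ) := by
  classical
  set PP := (Finset.univ.filter (fun P : Finset X => GoodC out inn (clo out P) S M t ψ ∧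
      (nbr out P).card = g ∧ (nbr out P).card = (clo out P).card + t)) with hPP
  rcases Finset.eq_empty_or_nonempty PP with he | ⟨P0, hP0⟩
  · rw [he]; simp; positivity
  have hP0' := (Finset.mem_filter.1 hP0).2
  by_cases hq : M.card + q ≤ g
  · have h1 : PP.card ≤ 2 ^ S.card := by
      rw [← Finset.card_powerset]
      apply Finset.card_le_card
      intro P hP
      rw [Finset.mem_powerset]
      exact (subset_clo out P).trans (Finset.mem_filter.1 hP).2.1.sub
    have h2 := goodC_card out inn hio d ho hi _ S M t ψ hP0'.1
    have h3 : (S.card : ℝ) ≤ g - ρ * t := by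
      have h2' : (d : ℝ) * S.card ≤ d * M.card + 8 * ψ * t := by exact_mod_cast h2
      have hdp : (0 : ℝ) < d := by exact_mod_cast hd
      have h4 : (S.card : ℝ) ≤ M.card + (8 * ψ * t : ℝ) / d := by
        rw [← sub_le_iff_le_add', le_div_iff₀ hdp]
        linarith
      have h5 : (M.card : ℝ) + q ≤ g := by exact_mod_cast hq
      linarith
    calc (PP.card : ℝ) ≤ (2 : ℝ) ^ S.card := by exact_mod_cast h1
      _ = (2 : ℝ) ^ (S.card : ℝ) := (Real.rpow_natCast _ _).symm
      _ ≤ _ := Real.rpow_le_rpow_of_exponent_le (by norm_num) h3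
  · push Not at hq
    set R := nbr out S \ M with hR
    have hRc := goodC_nbr out inn hio _ S M t ψ hP0'.1
    set SM := R.powerset.filter (fun T => T.card ≤ q) with hSM
    have hgt : t ≤ g := by have := hP0'.2.1; have := hP0'.2.2; omega
    have h1 : PP.card ≤ SM.card * 2 ^ (g - t) := by
      have hmap : ∀ P ∈ PP, nbr out P \ M ∈ SM := by
        intro P hP
        obtain ⟨hg, hn, hn2⟩ := (Finset.mem_filter.1 hP).2
        have hsubM := hg.subM
        rw [nbr_clo] at hsubM
        rw [hSM, Finset.mem_filter, Finset.mem_powerset]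
        constructor
        · refine Finset.sdiff_subset_sdiff ?_ le_rfl
          exact nbr_mono out ((subset_clo out P).trans hg.sub)
        · rw [Finset.card_sdiff_of_subset hsubM]; omega
      refine Finset.card_le_mul_card_image_of_maps_to hmap _ ?_ |>.trans (le_of_eq (mul_comm _ _))
      intro T hT
      rcases Finset.eq_empty_or_nonempty (PP.filter (fun P => nbr out P \ M = T)) with he | ⟨P1, hP1⟩
      · rw [he]; simp
      obtain ⟨hP1a, hP1b⟩ := Finset.mem_filter.1 hP1
      obtain ⟨hg1, hn1, hn12⟩ := (Finset.mem_filter.1 hP1a).2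
      have : (clo out P1).card = g - t := by omega
      rw [← this, ← Finset.card_powerset]
      apply Finset.card_le_card
      intro P hP
      obtain ⟨hPa, hPb⟩ := Finset.mem_filter.1 hP
      obtain ⟨hg2, hn2, hn22⟩ := (Finset.mem_filter.1 hPa).2
      rw [Finset.mem_powerset]
      have hs1 := hg1.subM
      have hs2 := hg2.subM
      rw [nbr_clo] at hs1 hs2
      have : nbr out P = nbr out P1 := by
        rw [← Finset.sdiff_union_of_subset hs1, ← Finset.sdiff_union_of_subset hs2, hPb, hP1b]
      have h2 : clo out P = clo out P1 := by unfold clo; rw [this]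
      rw [← h2]; exact subset_clo out P
    have h2 := small_subsets R q z hz hz1
    have h3 : (SM.card : ℝ) ≤ (2 : ℝ) ^ ((1 - ρ) * t) := by
      have hzq : 0 < z ^ q := by positivity
      have : (SM.card : ℝ) * z ^ q ≤ (2 : ℝ) ^ ((1 - ρ) * t) * z ^ q := by
        calc _ ≤ (1 + z) ^ R.card := h2
          _ ≤ (1 + z) ^ (8 * ψ * t) := pow_le_pow_right₀ (by linarith) hRc
          _ ≤ _ := hc2.trans (le_of_eq (mul_comm _ _))
      exact le_of_mul_le_mul_right this hzq
    calc (PP.card : ℝ) ≤ SM.card * 2 ^ (g - t) := by exact_mod_cast h1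
      _ ≤ (2 : ℝ) ^ ((1 - ρ) * t) * 2 ^ (g - t) := by gcongr
      _ = (2 : ℝ) ^ ((1 - ρ) * t) * (2 : ℝ) ^ ((g : ℝ) - t) := by
          rw [← Real.rpow_natCast, Nat.cast_sub hgt]
      _ = _ := by
          rw [← Real.rpow_add (by norm_num)]
          congr 1; ring
end cont

section iso
variable {G : Type*} [AddCommGroup G] [Fintype G] [DecidableEq G]

def dl (S : Finset G) (u : G) : ℕ := (S.filter (fun x => x + u ∉ S)).card

lemma dl_neg_compl (S : Finset G) (u : G) : dl Sᶜ u = dl S (-u) := by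
  unfold dl
  apply Finset.card_bij (fun x _ => x + u)
  · intro x hx; simp at hx ⊢; exact ⟨hx.2, hx.1⟩
  · intro a _ b _ h; simpa using h
  · intro y hy
    simp at hy
    refine ⟨y + -u, ?_, by simp⟩
    simp; exact ⟨hy.2, hy.1⟩

lemma dl_neg (S : Finset G) (u : G) : dl S (-u) = dl S u := by
  have key : ∀ u : G, (S.filter (fun x => x + u ∈ S)).card + dl S u = S.card := by
    intro u; exact Finset.card_filter_add_card_filter_not _
  have h : (S.filter (fun x => x + u ∈ S)).card = (S.filter (fun x => x + -u ∈ S)).card := by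
    apply Finset.card_bij (fun x _ => x + u)
    · intro x hx; simp at hx ⊢; exact ⟨hx.2, hx.1⟩
    · intro a _ b _ h; simpa using h
    · intro y hy
      simp at hy
      refine ⟨y + -u, ?_, by simp⟩
      simp; exact ⟨hy.2, hy.1⟩
  have h1 := key u
  have h2 := key (-u)
  omega

lemma dl_compl (S : Finset G) (u : G) : dl Sᶜ u = dl S u := by
  rw [dl_neg_compl, dl_neg]

lemma dl_zero (S : Finset G) : dl S 0 = 0 := by
  simp [dl]

lemma dl_add (S : Finset G) (u v : G) : dl S (u + v) ≤ dl S u + dl S v := by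
  unfold dl
  have : S.filter (fun x => x + (u+v) ∉ S) ⊆ S.filter (fun x => x + u ∉ S) ∪
      ((S.filter (fun x => x + v ∉ S)).image (fun x => x - u)) := by
    intro x hx
    simp only [Finset.mem_union, Finset.mem_filter, Finset.mem_image] at hx ⊢
    by_cases h : x + u ∈ S
    · right
      exact ⟨x + u, ⟨h, by rw [add_assoc]; exact hx.2⟩, by simp⟩
    · left; exact ⟨hx.1, h⟩
  refine (Finset.card_le_card this).trans ((Finset.card_union_le _ _).trans ?_)
  exact Nat.add_le_add_left Finset.card_image_le _

lemma dl_approx (S S' : Finset G) (u : G) : dl S' u ≤ dl S u + ((S' \ S).card + (S \ S').card) := by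
  unfold dl
  have : S'.filter (fun x => x + u ∉ S') ⊆ S.filter (fun x => x + u ∉ S) ∪
      ((S' \ S) ∪ ((S \ S').image (fun x => x - u))) := by
    intro x hx
    simp only [Finset.mem_union, Finset.mem_filter, Finset.mem_image, Finset.mem_sdiff] at hx ⊢
    by_cases h : x ∈ S
    · by_cases h2 : x + u ∈ S
      · right; right
        exact ⟨x + u, ⟨h2, hx.2⟩, by simp⟩
      · left; exact ⟨h, h2⟩
    · right; left; exact ⟨hx.1, h⟩
  refine (Finset.card_le_card this).trans ((Finset.card_union_le _ _).trans ?_)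
  refine Nat.add_le_add_left ((Finset.card_union_le _ _).trans ?_) _
  exact Nat.add_le_add_left Finset.card_image_le _

/-- iterated sumset -/
def itS (Q : Finset G) : ℕ → Finset G
  | 0 => {0}
  | k+1 => (itS Q k ×ˢ Q).image (fun p => p.1 + p.2)

lemma mem_itS_succ (Q : Finset G) (k : ℕ) (x : G) : x ∈ itS Q (k+1) ↔ ∃ a ∈ itS Q k, ∃ b ∈ Q, a + b = x := by
  simp only [itS, Finset.mem_image, Finset.mem_product, Prod.exists]
  constructor
  · rintro ⟨a, b, ⟨h1, h2⟩, h3⟩; exact ⟨a, h1, b, h2, h3⟩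
  · rintro ⟨a, h1, b, h2, h3⟩; exact ⟨a, b, ⟨h1, h2⟩, h3⟩

lemma itS_mono (Q : Finset G) (h0 : (0:G) ∈ Q) (k : ℕ) : itS Q k ⊆ itS Q (k+1) := by
  intro x hx
  rw [mem_itS_succ]
  exact ⟨x, hx, 0, h0, add_zero x⟩

lemma itS_mono' (Q : Finset G) (h0 : (0:G) ∈ Q) {k l : ℕ} (h : k ≤ l) : itS Q k ⊆ itS Q l := by
  induction h with
  | refl => exact le_rfl
  | step _ ih => exact ih.trans (itS_mono Q h0 _)

lemma zero_mem_itS (Q : Finset G) (h0 : (0:G) ∈ Q) (k : ℕ) : (0:G) ∈ itS Q k :=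
  itS_mono' Q h0 (Nat.zero_le k) (by simp [itS])

lemma itS_stab (Q : Finset G) (h0 : (0:G) ∈ Q) {k l : ℕ} (h : k ≤ l) (hs : itS Q (k+1) = itS Q k) :
    itS Q l = itS Q k := by
  induction h with
  | refl => rfl
  | @step m hm ih =>
    ext x
    rw [Nat.succ_eq_add_one, mem_itS_succ, ih, ← mem_itS_succ, hs]

lemma itS_sub_closure (Q : Finset G) (k : ℕ) (x : G) (hx : x ∈ itS Q k) : x ∈ AddSubgroup.closure (Q : Set G) := by
  induction k generalizing x with
  | zero => simp [itS] at hx; subst hx; exact zero_mem _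
  | succ k ih =>
    rw [mem_itS_succ] at hx
    obtain ⟨a, ha, b, hb, rfl⟩ := hx
    exact add_mem (ih a ha) (AddSubgroup.subset_closure hb)

lemma closure_sub_itS (Q : Finset G) (h0 : (0:G) ∈ Q) (hn : ∀ x ∈ Q, -x ∈ Q) (k : ℕ)
    (hs : itS Q (k+1) = itS Q k) (x : G) (hx : x ∈ AddSubgroup.closure (Q : Set G)) : x ∈ itS Q k := by
  have : ∀ a, a ∈ itS Q k → a + x ∈ itS Q k := by
    induction hx using AddSubgroup.closure_induction with
    | mem y hy =>
      intro a ha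
      rw [← hs, mem_itS_succ]; exact ⟨a, ha, y, hy, rfl⟩
    | zero => simp
    | add y z _ _ h1 h2 => intro a ha; rw [← add_assoc]; exact h2 _ (h1 _ ha)
    | neg y _ h =>
      intro a ha
      -- the map a ↦ a + y is injective on itS, hence surjective
      have himg : (itS Q k).image (fun a => a + y) = itS Q k := by
        apply Finset.eq_of_subset_of_card_le
        · intro z hz
          obtain ⟨b, hb, rfl⟩ := Finset.mem_image.1 hz
          exact h b hb
        · rw [Finset.card_image_of_injective _ (add_left_injective y)]
      rw [← himg] at ha
      obtain ⟨b, hb, rfl⟩ := Finset.mem_image.1 ha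
      simpa using hb
  simpa using this 0 (zero_mem_itS Q h0 k)

lemma itS_growth (Q : Finset G) (h0 : (0:G) ∈ Q) (hn : ∀ x ∈ Q, -x ∈ Q) (k : ℕ)
    (hs : itS Q (k+1) ≠ itS Q k) : k * Q.card ≤ 3 * (itS Q k).card := by
  have h1 : (itS Q 1) = Q := by
    ext x; rw [show (1:ℕ) = 0 + 1 from rfl, mem_itS_succ]; simp [itS]
  induction k using Nat.strong_induction_on with
  | _ k ih =>
    have hle : ∀ m, 1 ≤ m → Q.card ≤ (itS Q m).card := by
      intro m hm
      calc Q.card = (itS Q 1).card := by rw [h1]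
        _ ≤ _ := Finset.card_le_card (itS_mono' Q h0 hm)
    match k, hs, ih with
    | 0, _, _ => simp
    | 1, _, _ => have := hle 1 le_rfl; omega
    | 2, _, _ => have := hle 2 (by norm_num); omega
    | m+3, hs, ih =>
      have hns : ∀ j, j ≤ m+3 → itS Q (j+1) ≠ itS Q j := by
        intro j hj hst
        apply hs
        rw [itS_stab Q h0 hj hst, itS_stab Q h0 (by omega : j ≤ m+3+1) hst]
      have hm := ih m (by omega) (hns m (by omega))
      have : ∃ x ∈ itS Q (m+2), x ∉ itS Q (m+1) := by
        by_contra hcon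
        push Not at hcon
        exact hns (m+1) (by omega) (le_antisymm hcon (itS_mono Q h0 _))
      obtain ⟨x, hx, hx'⟩ := this
      have hdis : Disjoint (itS Q m) (Q.image (fun y => x + y)) := by
        rw [Finset.disjoint_left]
        intro a ha hb
        obtain ⟨y, hy, rfl⟩ := Finset.mem_image.1 hb
        apply hx'
        rw [mem_itS_succ]
        exact ⟨x + y, ha, -y, hn y hy, by simp⟩
      have hsub : itS Q m ∪ Q.image (fun y => x + y) ⊆ itS Q (m+3) := by
        apply Finset.union_subset (itS_mono' Q h0 (by omega))
        intro a ha
        obtain ⟨y, hy, rfl⟩ := Finset.mem_image.1 ha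
        rw [mem_itS_succ]; exact ⟨x, hx, y, hy, rfl⟩
      have := Finset.card_le_card hsub
      rw [Finset.card_union_of_disjoint hdis, Finset.card_image_of_injective _ (add_right_injective x)] at this
      nlinarith

lemma dl_itS (S : Finset G) (Q : Finset G) (b : ℝ) (hQ : ∀ u ∈ Q, (dl S u : ℝ) ≤ b) (k : ℕ) (u : G)
    (hu : u ∈ itS Q k) : (dl S u : ℝ) ≤ k * b := by
  induction k generalizing u with
  | zero => simp [itS] at hu; subst hu; simp [dl_zero]
  | succ k ih =>
    rw [mem_itS_succ] at hu
    obtain ⟨x, hx, y, hy, rfl⟩ := hu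
    have h1 : (dl S (x + y) : ℝ) ≤ dl S x + dl S y := by exact_mod_cast dl_add S x y
    have h2 := ih x hx
    have h3 := hQ y hy
    push_cast; linarith

/-- averaging: if each point of T sees at most s points of T inside x + B -/
lemma dl_avg (T B : Finset G) (b : ℝ) (hs : ∀ x ∈ T, 2 * (B.filter (fun u => x + u ∈ T)).card ≤ B.card)
    (hB : 0 < B.card) (hb : ∀ u ∈ B, (dl T u : ℝ) ≤ b) : (T.card : ℝ) ≤ 2 * b := by
  have h1 : ∑ u ∈ B, dl T u = ∑ x ∈ T, (B.filter (fun u => x + u ∉ T)).card := by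
    unfold dl
    have := Finset.sum_card_bipartiteAbove_eq_sum_card_bipartiteBelow (s := B) (t := T) (fun u x => x + u ∉ T)
    exact this
  have h2 : T.card * B.card ≤ 2 * ∑ u ∈ B, dl T u := by
    rw [h1, Finset.mul_sum, ← smul_eq_mul]
    apply Finset.card_nsmul_le_sum
    intro x hx
    have := hs x hx
    have h3 : (B.filter (fun u => x + u ∈ T)).card + (B.filter (fun u => x + u ∉ T)).card = B.card :=
      Finset.card_filter_add_card_filter_not _
    omega
  have h3 : (∑ u ∈ B, (dl T u : ℝ)) ≤ B.card * b := by
    rw [← nsmul_eq_mul]; exact Finset.sum_le_card_nsmul _ _ _ hb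
  have h4 : (T.card * B.card : ℝ) ≤ 2 * ∑ u ∈ B, (dl T u : ℝ) := by exact_mod_cast h2
  have h5 : (0:ℝ) < B.card := by exact_mod_cast hB
  have h6 : (T.card * B.card : ℝ) ≤ (2 * b) * B.card := by linarith
  exact le_of_mul_le_mul_right h6 h5

end iso

section iso2
variable {G : Type*} [AddCommGroup G] [Fintype G] [DecidableEq G]

open Classical in
noncomputable def cst (H : AddSubgroup G) (x : G) : Finset G := Finset.univ.filter (fun y => y - x ∈ H)

lemma cst_card (H : AddSubgroup G) (x : G) : (cst H x).card = Nat.card H := by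
  classical
  rw [Nat.card_eq_fintype_card, ← Finset.card_univ (α := H)]
  symm
  apply Finset.card_bij (fun (h : H) _ => x + (h : G))
  · intro a _; simp [cst]
  · intro a _ b _ h; simpa using h
  · intro y hy
    simp [cst] at hy
    exact ⟨⟨y - x, hy⟩, Finset.mem_univ _, by simp⟩

lemma mem_cst (H : AddSubgroup G) (x y : G) : y ∈ cst H x ↔ y - x ∈ H := by
  classical
  simp [cst]

lemma cst_eq (H : AddSubgroup G) (x y : G) (h : y - x ∈ H) : cst H y = cst H x := by
  ext z
  rw [mem_cst, mem_cst]
  constructor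
  · intro h2; have := add_mem h2 h; simpa using this
  · intro h2; have := sub_mem h2 h; simpa using this

theorem iso_core (Q : Finset G) (h0 : (0:G) ∈ Q) (hn : ∀ x ∈ Q, -x ∈ Q) (S : Finset G) (b : ℝ)
    (hQ : ∀ u ∈ Q, (dl S u : ℝ) ≤ b) (hb : 48 * b ≤ Q.card) :
    ∃ S' : Finset G, (∀ x, ∀ h ∈ AddSubgroup.closure (Q : Set G), x + h ∈ S' ↔ x ∈ S') ∧
      (((S' \ S).card + (S \ S').card : ℕ) : ℝ) ≤ 4 * b := by
  classical
  set H := AddSubgroup.closure (Q : Set G) with hH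
  set S' : Finset G := Finset.univ.filter (fun x => Nat.card H < 2 * (S ∩ cst H x).card) with hS'
  have hinv : ∀ x, ∀ h ∈ H, x + h ∈ S' ↔ x ∈ S' := by
    intro x h hh
    simp only [hS', Finset.mem_filter, Finset.mem_univ, true_and]
    rw [cst_eq H x (x + h) (by simpa using hh)]
  refine ⟨S', hinv, ?_⟩
  set R := (S' \ S) ∪ (S \ S') with hR
  have hRc : R.card = (S' \ S).card + (S \ S').card := by
    apply Finset.card_union_of_disjoint
    rw [Finset.disjoint_left]; intro a; simp; tauto
  rw [← hRc]
  have hdlR : ∀ u ∈ H, dl R u ≤ 2 * dl S u := by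
    intro u hu
    have : dl R u ≤ dl S u + dl Sᶜ u := by
      unfold dl
      refine (Finset.card_le_card ?_).trans (Finset.card_union_le _ _)
      intro x hx
      have hi := hinv x u hu
      simp only [hR, Finset.mem_filter, Finset.mem_union, Finset.mem_sdiff, Finset.mem_compl] at hx ⊢
      rw [hi] at hx
      tauto
    rw [dl_compl] at this; omega
  have hsm : ∀ x, 2 * (R ∩ cst H x).card ≤ Nat.card H := by
    intro x
    by_cases hx : x ∈ S'
    · have h1 : R ∩ cst H x ⊆ cst H x \ S := by
        intro y hy
        simp only [hR, Finset.mem_inter, Finset.mem_union, Finset.mem_sdiff] at hy ⊢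
        have h2 := hinv x (y - x) ((mem_cst H x y).1 hy.2)
        rw [add_sub_cancel] at h2
        tauto
      have h3 := Finset.card_le_card h1
      have h4 := Finset.card_sdiff_add_card_inter (cst H x) S
      rw [cst_card, Finset.inter_comm] at h4
      simp only [hS', Finset.mem_filter, Finset.mem_univ, true_and] at hx
      omega
    · have h1 : R ∩ cst H x ⊆ S ∩ cst H x := by
        intro y hy
        simp only [hR, Finset.mem_inter, Finset.mem_union, Finset.mem_sdiff] at hy ⊢
        have h2 := hinv x (y - x) ((mem_cst H x y).1 hy.2)
        rw [add_sub_cancel] at h2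
        tauto
      have h3 := Finset.card_le_card h1
      simp only [hS', Finset.mem_filter, Finset.mem_univ, true_and] at hx
      omega
  have hQ1 : 0 < Q.card := Finset.card_pos.2 ⟨0, h0⟩
  by_cases hall : ∀ x, 2 * (R ∩ cst H x).card ≤ Q.card
  · have := dl_avg R Q (2 * b) ?_ hQ1 ?_
    · linarith
    · intro x hx
      refine le_trans (Nat.mul_le_mul_left 2 ?_) (hall x)
      apply Finset.card_le_card_of_injOn (fun u => x + u)
      · intro u hu
        simp only [Finset.coe_filter, Set.mem_setOf_eq] at hu
        simp only [Finset.coe_inter, Set.mem_inter_iff, Finset.mem_coe, mem_cst]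
        refine ⟨hu.2, ?_⟩
        simp
        exact AddSubgroup.subset_closure hu.1
      · intro a _ c _ h; simpa using h
    · intro u hu
      have h1 : (dl R u : ℝ) ≤ 2 * dl S u := by
        exact_mod_cast hdlR u (AddSubgroup.subset_closure hu)
      have := hQ u hu
      linarith
  · exfalso
    push Not at hall
    obtain ⟨x0, hx0⟩ := hall
    set T := R ∩ cst H x0 with hT
    have hdlT : ∀ u ∈ H, (dl T u : ℝ) ≤ 2 * dl S u := by
      intro u hu
      have : dl T u ≤ dl R u := by
        apply Finset.card_le_card
        intro x hx
        simp only [hT, Finset.mem_filter, Finset.mem_inter, mem_cst] at hx ⊢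
        refine ⟨hx.1.1, fun h => hx.2 ⟨h, ?_⟩⟩
        have := add_mem hx.1.2 hu
        rwa [show x + u - x0 = x - x0 + u by abel]
      exact_mod_cast this.trans (hdlR u hu)
    have hTH := hsm x0
    rw [← hT] at hTH
    -- some k is large
    have hstab : ∀ k, itS Q (k+1) = itS Q k → 2 * T.card ≤ (itS Q k).card := by
      intro k hk
      have : Nat.card H ≤ (itS Q k).card := by
        rw [← cst_card H 0]
        apply Finset.card_le_card
        intro y hy
        rw [mem_cst, sub_zero] at hy
        exact closure_sub_itS Q h0 hn k hk y hy
      omega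
    have hex : ∃ k, 2 * T.card ≤ (itS Q k).card := by
      by_contra hcon
      push Not at hcon
      have hgr : ∀ k, k < (itS Q k).card := by
        intro k
        induction k with
        | zero => simp [itS]
        | succ k ih =>
          have : itS Q k ⊂ itS Q (k+1) := by
            apply lt_of_le_of_ne (itS_mono Q h0 k)
            intro h
            have := hstab k h.symm
            have := hcon k
            omega
          have := Finset.card_lt_card this
          omega
      have := hgr (2 * T.card)
      have := hcon (2 * T.card)
      omega
    obtain ⟨k, hk, hmin⟩ : ∃ k, 2 * T.card ≤ (itS Q k).card ∧ ∀ m < k, (itS Q m).card < 2 * T.card := by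
      refine ⟨Nat.find hex, Nat.find_spec hex, ?_⟩
      intro m hm
      have := Nat.find_min hex hm
      omega
    have h1 : (itS Q 1) = Q := by
      ext x; rw [show (1:ℕ) = 0 + 1 from rfl, mem_itS_succ]; simp [itS]
    have hk2 : 2 ≤ k := by
      rcases k with _ | _ | k
      · simp [itS] at hk
        omega
      · rw [zero_add, h1] at hk; omega
      · omega
    have havg := dl_avg T (itS Q k) (k * (2 * b)) ?_ (Finset.card_pos.2 ⟨0, zero_mem_itS Q h0 k⟩) ?_
    · obtain ⟨m, rfl⟩ : ∃ m, k = m + 1 := ⟨k - 1, by omega⟩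
      have hm := hmin m (by omega)
      have hg := itS_growth Q h0 hn m (fun h => by have := hstab m h; omega)
      have h6 : m * Q.card + 1 ≤ 6 * T.card := by omega
      have h7 : (m * Q.card + 1 : ℝ) ≤ 6 * T.card := by exact_mod_cast h6
      have h8 : (1:ℝ) ≤ m := by exact_mod_cast (by omega : 1 ≤ m)
      have hT0 : (0:ℝ) ≤ b := le_trans (Nat.cast_nonneg _) (hQ 0 h0)
      push_cast at havg
      nlinarith
    · intro x hx
      refine le_trans (Nat.mul_le_mul_left 2 ?_) hk
      apply Finset.card_le_card_of_injOn (fun u => x + u)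
      · intro u hu
        simp only [Finset.coe_filter, Set.mem_setOf_eq] at hu
        exact hu.2
      · intro a _ c _ h; simpa using h
    · intro u hu
      apply dl_itS T Q (2*b) ?_ k u hu
      intro v hv
      have h1 := hdlT v (AddSubgroup.subset_closure hv)
      have := hQ v hv
      linarith

theorem iso (D S : Finset G) (d : ℕ) (hD : D.card = d) (hd : 0 < d) (hS : d ≤ 2 * S.card) (hSc : d ≤ 2 * Sᶜ.card)
    (η : ℝ) (hη : ∑ e ∈ D, ∑ e' ∈ D, (dl S (e - e') : ℝ) ≤ η * d ^ 2) (hη2 : 384 * η ≤ d) :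
    ∃ K : AddSubgroup G, K ≠ ⊤ ∧ d ≤ 2 * Nat.card K ∧ ∀ u, u ∉ K → Nat.card K ≤ 2 * dl S u := by
  classical
  have hdR : (0:ℝ) < d := by exact_mod_cast hd
  set r : G → ℝ := fun e => ∑ e' ∈ D, (dl S (e - e') : ℝ) with hr
  have hr0 : ∀ e, 0 ≤ r e := fun e => Finset.sum_nonneg fun _ _ => Nat.cast_nonneg _
  have hη0 : 0 ≤ η := by
    have : 0 ≤ η * d^2 := le_trans (Finset.sum_nonneg fun e _ => hr0 e) hη
    by_contra h
    push Not at h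
    have : η * d^2 < 0 := mul_neg_of_neg_of_pos h (by positivity)
    linarith
  set Ds := D.filter (fun e => r e ≤ 2 * η * d) with hDs
  have hDsc : d ≤ 2 * Ds.card := by
    have h1 : Ds.card + (D.filter (fun e => ¬ r e ≤ 2 * η * d)).card = D.card :=
      Finset.card_filter_add_card_filter_not _
    set Bd := D.filter (fun e => ¬ r e ≤ 2 * η * d) with hBd
    rcases Finset.eq_empty_or_nonempty Bd with hB | hB
    · rw [hB] at h1; simp at h1; omega
    have h2 : Bd.card * (2 * η * d) < η * d ^ 2 := by
      calc Bd.card * (2 * η * d) = ∑ e ∈ Bd, 2 * η * d := by simp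
        _ < ∑ e ∈ Bd, r e := by
            apply Finset.sum_lt_sum_of_nonempty hB
            intro e he
            simp only [hBd, Finset.mem_filter, not_le] at he
            exact he.2
        _ ≤ ∑ e ∈ D, r e := Finset.sum_le_sum_of_subset_of_nonneg (Finset.filter_subset _ _) (fun e _ _ => hr0 e)
        _ ≤ _ := hη
    by_contra hcon
    push Not at hcon
    have h3 : d < 2 * Bd.card := by omega
    have h4 : (d:ℝ) ≤ 2 * Bd.card := by exact_mod_cast h3.le
    have h5 : (d:ℝ) * (η * d) ≤ 2 * Bd.card * (η * d) := mul_le_mul_of_nonneg_right h4 (by positivity)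
    nlinarith
  have hdiff : ∀ e ∈ Ds, ∀ e' ∈ Ds, (dl S (e - e') : ℝ) ≤ 4 * η := by
    intro e he e' he'
    have h1 : (d:ℝ) * dl S (e - e') ≤ r e + r e' := by
      rw [hr]
      simp only
      rw [← Finset.sum_add_distrib, ← hD, ← nsmul_eq_mul]
      apply Finset.card_nsmul_le_sum
      intro f hf
      have h1 := dl_add S (e - f) (f - e')
      rw [show e - f + (f - e') = e - e' by abel, ← neg_sub e' f, dl_neg] at h1
      exact_mod_cast h1
    have h2 := (Finset.mem_filter.1 he).2
    have h3 := (Finset.mem_filter.1 he').2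
    have h4 : (d:ℝ) * dl S (e - e') ≤ d * (4 * η) := by linarith
    exact le_of_mul_le_mul_left h4 hdR
  have hne : Ds.Nonempty := by rw [← Finset.card_pos]; omega
  obtain ⟨f0, hf0⟩ := hne
  set Q := (Ds ×ˢ Ds).image (fun p => p.1 - p.2) with hQ
  have hmQ : ∀ x, x ∈ Q ↔ ∃ a ∈ Ds, ∃ b ∈ Ds, a - b = x := by
    intro x
    simp only [hQ, Finset.mem_image, Finset.mem_product, Prod.exists]
    constructor
    · rintro ⟨a, b, ⟨h1, h2⟩, h3⟩; exact ⟨a, h1, b, h2, h3⟩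
    · rintro ⟨a, h1, b, h2, h3⟩; exact ⟨a, b, ⟨h1, h2⟩, h3⟩
  have hQc : Ds.card ≤ Q.card := by
    apply Finset.card_le_card_of_injOn (fun e => e - f0)
    · intro e he; rw [Finset.mem_coe, hmQ]; exact ⟨e, he, f0, hf0, rfl⟩
    · intro a _ c _ h; simpa using h
  have hQc' : (d:ℝ) ≤ 2 * Q.card := by exact_mod_cast (by omega : d ≤ 2 * Q.card)
  obtain ⟨S', hinv, hS'⟩ := iso_core Q ((hmQ 0).2 ⟨f0, hf0, f0, hf0, sub_self _⟩)
    (by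
      intro x hx
      rw [hmQ] at hx ⊢
      obtain ⟨a, ha, b, hb, rfl⟩ := hx
      exact ⟨b, hb, a, ha, by abel⟩) S (4 * η)
    (by
      intro u hu
      rw [hmQ] at hu
      obtain ⟨a, ha, b, hb, rfl⟩ := hu
      exact hdiff a ha b hb) (by linarith)
  have hS'' : (((S' \ S).card : ℝ) + (S \ S').card) * 24 ≤ d := by push_cast at hS'; linarith
  have hS3 : ((S' \ S).card + (S \ S').card) * 24 ≤ d := by exact_mod_cast hS''
  let K : AddSubgroup G :=
    { carrier := {g | ∀ x, x + g ∈ S' ↔ x ∈ S'}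
      zero_mem' := by simp
      add_mem' := by
        intro a b ha hb x
        rw [← add_assoc, hb, ha]
      neg_mem' := by
        intro a ha x
        rw [← ha (x + -a)]; simp }
  have hmK : ∀ g, g ∈ K ↔ ∀ x, x + g ∈ S' ↔ x ∈ S' := fun g => Iff.rfl
  have hKc : d ≤ 2 * Nat.card K := by
    have h1 : Ds.card ≤ (cst K f0).card := by
      apply Finset.card_le_card
      intro e he
      rw [mem_cst, hmK]
      intro x
      exact hinv x _ (AddSubgroup.subset_closure ((hmQ _).2 ⟨e, he, f0, hf0, rfl⟩))
    rw [cst_card] at h1; omega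
  refine ⟨K, ?_, hKc, ?_⟩
  · intro htop
    have hall : ∀ x y, x ∈ S' → y ∈ S' := by
      intro x y hx
      have : y - x ∈ K := by rw [htop]; trivial
      rw [hmK] at this
      have h2 := (this x).2 hx
      simpa using h2
    rcases Finset.eq_empty_or_nonempty S' with h | ⟨x, hx⟩
    · rw [h] at hS3; simp at hS3; omega
    · have : S' = Finset.univ := by
        ext y; simp; exact hall x y hx
      rw [this] at hS3
      rw [← Finset.compl_eq_univ_sdiff] at hS3
      omega
  · intro u hu
    have h1 : Nat.card K ≤ dl S' u := by
      have : ∃ x ∈ S', x + u ∉ S' := by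
        by_contra hcon
        push Not at hcon
        have hz : dl S' u = 0 := by
          unfold dl; rw [Finset.card_eq_zero, Finset.filter_eq_empty_iff]
          intro x hx; simp [hcon x hx]
        have hz2 : dl S' (-u) = 0 := by rw [dl_neg, hz]
        unfold dl at hz2; rw [Finset.card_eq_zero, Finset.filter_eq_empty_iff] at hz2
        apply hu
        rw [hmK]
        intro x
        refine ⟨fun h => ?_, hcon x⟩
        have := hz2 h
        simpa using this
      obtain ⟨x, hx, hxu⟩ := this
      rw [← cst_card K x]
      unfold dl
      apply Finset.card_le_card
      intro y hy
      rw [mem_cst, hmK] at hy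
      simp only [Finset.mem_filter]
      constructor
      · have := (hy x).2 hx; simpa using this
      · intro h
        apply hxu
        rw [← hy (x + u)]
        rwa [show x + u + (y - x) = y + u by abel]
    have h2 := dl_approx S S' u
    omega

end iso2

section wts
variable {G : Type*} [AddCommGroup G] [Fintype G] [DecidableEq G]

open Classical in
noncomputable def outK (D : Finset G) (e0 : G) (K : AddSubgroup G) : Finset G := D.filter (fun e => e - e0 ∉ K)

lemma mem_outK (D : Finset G) (e0 : G) (K : AddSubgroup G) (e : G) : e ∈ outK D e0 K ↔ e ∈ D ∧ e - e0 ∉ K := by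
  classical
  simp [outK]

lemma outK_add (D : Finset G) (e0 : G) (K : AddSubgroup G) : D.card ≤ (outK D e0 K).card + Nat.card K := by
  rw [← cst_card K e0]
  refine le_trans (Finset.card_le_card ?_) (Finset.card_union_le _ _)
  intro e he
  rw [Finset.mem_union, mem_outK, mem_cst]
  tauto

lemma outK_inf (D : Finset G) (e0 : G) (K K' : AddSubgroup G) :
    (outK D e0 (K ⊓ K')).card ≤ (outK D e0 K).card + (outK D e0 K').card := by
  refine le_trans (Finset.card_le_card ?_) (Finset.card_union_le _ _)
  intro e he
  rw [Finset.mem_union, mem_outK, mem_outK]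
  rw [mem_outK, AddSubgroup.mem_inf] at he
  tauto

lemma outK_pos (D : Finset G) (e0 : G) (hgen : AddSubgroup.closure ((fun e => e - e0) '' (D : Set G)) = ⊤)
    (K : AddSubgroup G) (hK : K ≠ ⊤) : 1 ≤ (outK D e0 K).card := by
  by_contra h
  push Not at h
  have h0 : outK D e0 K = ∅ := by rw [← Finset.card_eq_zero]; omega
  apply hK
  rw [eq_top_iff, ← hgen, AddSubgroup.closure_le]
  rintro _ ⟨e, he, rfl⟩
  by_contra hcon
  have : e ∈ outK D e0 K := (mem_outK _ _ _ _).2 ⟨he, hcon⟩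
  rw [h0] at this
  simp at this

lemma card_half (I K : AddSubgroup G) (h : I ≤ K) (hne : I ≠ K) : 2 * Nat.card I ≤ Nat.card K := by
  have hdvd := AddSubgroup.card_dvd_of_le h
  obtain ⟨c, hc⟩ := hdvd
  have hp : 0 < Nat.card K := Nat.card_pos
  have hpI : 0 < Nat.card I := Nat.card_pos
  have : c ≠ 1 := by
    intro h1
    rw [h1, mul_one] at hc
    exact hne (AddSubgroup.eq_of_le_of_card_ge h hc.le)
  have : c ≠ 0 := by intro h1; rw [h1] at hc; omega
  have : 2 ≤ c := by omega
  rw [hc, mul_comm]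
  exact Nat.mul_le_mul_left _ this

lemma exists_low (D : Finset G) (e0 : G) (d : ℕ) (hD : D.card = d) (j : ℕ) :
    ∃ H : AddSubgroup G, (outK D e0 H).card ≤ 8 * 2 ^ j ∧
      ∀ K : AddSubgroup G, d ≤ 2 * Nat.card K → (outK D e0 K).card * Nat.card K ≤ 2 ^ j * d → H ≤ K := by
  classical
  by_cases hj : d ≤ 8 * 2 ^ j
  · refine ⟨⊥, ?_, fun K _ _ => bot_le⟩
    refine le_trans (Finset.card_le_card ?_) (hD.le.trans hj)
    intro e he; exact ((mem_outK _ _ _ _).1 he).1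
  push Not at hj
  set 𝓑 : Set (AddSubgroup G) := {K | d ≤ 2 * Nat.card K ∧ (outK D e0 K).card * Nat.card K ≤ 2 ^ j * d} with h𝓑
  have hb : ∀ K ∈ 𝓑, (outK D e0 K).card ≤ 2 * 2 ^ j := by
    rintro K ⟨h1, h2⟩
    have : (outK D e0 K).card * d ≤ 2 * 2 ^ j * d := by nlinarith
    exact Nat.le_of_mul_le_mul_right this (by omega)
  have hinf : ∀ K ∈ 𝓑, ∀ K' ∈ 𝓑, K ⊓ K' ∈ 𝓑 := by
    intro K hK K' hK'
    by_cases h1 : K ⊓ K' = K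
    · rwa [h1]
    by_cases h2 : K ⊓ K' = K'
    · rwa [h2]
    have h3 := card_half _ _ inf_le_left h1
    have h4 := card_half _ _ inf_le_right h2
    have h5 := outK_inf D e0 K K'
    have h6 := outK_add D e0 (K ⊓ K')
    have h7 := hb K hK
    have h8 := hb K' hK'
    refine ⟨by omega, ?_⟩
    obtain ⟨_, h9⟩ := hK
    obtain ⟨_, h10⟩ := hK'
    have : (outK D e0 (K ⊓ K')).card * (2 * Nat.card (K ⊓ K' : AddSubgroup G)) ≤
        (outK D e0 K).card * Nat.card K + (outK D e0 K').card * Nat.card K' := by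
      calc _ ≤ ((outK D e0 K).card + (outK D e0 K').card) * (2 * Nat.card (K ⊓ K' : AddSubgroup G)) :=
            Nat.mul_le_mul_right _ h5
        _ = (outK D e0 K).card * (2 * Nat.card (K ⊓ K' : AddSubgroup G)) + (outK D e0 K').card * (2 * Nat.card (K ⊓ K' : AddSubgroup G)) := by ring
        _ ≤ _ := Nat.add_le_add (Nat.mul_le_mul_left _ h3) (Nat.mul_le_mul_left _ h4)
    nlinarith
  have htop : (⊤ : AddSubgroup G) ∈ 𝓑 := by
    constructor
    · have h1 : Nat.card (⊤ : AddSubgroup G) = Fintype.card G := by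
        rw [AddSubgroup.card_top, Nat.card_eq_fintype_card]
      rw [h1]
      have := Finset.card_le_univ D
      omega
    · have : outK D e0 ⊤ = ∅ := by
        rw [Finset.eq_empty_iff_forall_notMem]
        intro e he; rw [mem_outK] at he; exact he.2 trivial
      rw [this]; simp
  obtain ⟨M, hM, hmin⟩ := (Set.toFinite 𝓑).exists_minimal ⟨⊤, htop⟩
  refine ⟨M, (hb M hM).trans (by omega), fun K h1 h2 => ?_⟩
  exact (hmin (hinf M hM K ⟨h1, h2⟩) inf_le_left).trans inf_le_right

theorem weights (D : Finset G) (e0 : G) (d : ℕ) (hD : D.card = d) (hd : 0 < d) (J : ℕ) (hJ : d ≤ 2 ^ J)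
    (hgen : AddSubgroup.closure ((fun e => e - e0) '' (D : Set G)) = ⊤) :
    ∃ w : G → ℝ, (∀ e, 0 ≤ w e) ∧ ∑ e ∈ D, w e ≤ 9 + 8 * J ∧
      ∀ K : AddSubgroup G, K ≠ ⊤ → d ≤ 2 * Nat.card K →
        (d : ℝ) / 2 ≤ (∑ e ∈ outK D e0 K, w e) * Nat.card K := by
  classical
  choose H hH1 hH2 using fun j => exists_low D e0 d hD j
  have hdR : (0:ℝ) < d := by exact_mod_cast hd
  refine ⟨fun e => 1 / d + ∑ j ∈ Finset.range (J+1), if e - e0 ∉ H j then (1:ℝ) / 2 ^ j else 0, ?_, ?_, ?_⟩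
  · intro e
    refine add_nonneg (by positivity) (Finset.sum_nonneg fun j _ => ?_)
    split_ifs <;> positivity
  · rw [Finset.sum_add_distrib, Finset.sum_comm]
    have h1 : ∑ e ∈ D, (1:ℝ) / d = 1 := by
      rw [Finset.sum_const, hD, nsmul_eq_mul]; field_simp
    have h2 : ∀ j ∈ Finset.range (J+1), ∑ e ∈ D, (if e - e0 ∉ H j then (1:ℝ) / 2 ^ j else 0) ≤ 8 := by
      intro j _
      rw [← Finset.sum_filter, Finset.sum_const, nsmul_eq_mul]
      have h3 : ((D.filter (fun e => e - e0 ∉ H j)).card : ℝ) ≤ 8 * 2 ^ j := by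
        have h4 := hH1 j
        have h5 : D.filter (fun e => e - e0 ∉ H j) = outK D e0 (H j) := by
          ext e; rw [mem_outK]; simp
        rw [h5]; exact_mod_cast h4
      rw [mul_one_div, div_le_iff₀ (by positivity)]
      exact h3
    have := Finset.sum_le_card_nsmul _ _ _ h2
    rw [Finset.card_range, nsmul_eq_mul] at this
    push_cast at this
    linarith
  · intro K hK hKd
    set b := (outK D e0 K).card with hb
    have hb1 : 1 ≤ b := outK_pos D e0 hgen K hK
    have hB : d ≤ 2 * (b * Nat.card K) := by nlinarith
    have hKp : (0:ℝ) < Nat.card K := by exact_mod_cast Nat.card_pos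
    by_cases hbig : 2 ^ J * d < b * Nat.card K
    · have h1 : (b:ℝ) * (1 / d) ≤ ∑ e ∈ outK D e0 K, (1 / d + ∑ j ∈ Finset.range (J+1), if e - e0 ∉ H j then (1:ℝ) / 2 ^ j else 0) := by
        rw [hb, ← nsmul_eq_mul]
        apply Finset.card_nsmul_le_sum
        intro e _
        refine le_add_of_nonneg_right (Finset.sum_nonneg fun j _ => ?_)
        split_ifs <;> positivity
      refine le_trans ?_ (mul_le_mul_of_nonneg_right h1 hKp.le)
      have h2 : (d:ℝ) * d ≤ b * Nat.card K := by
        have : d * d ≤ b * Nat.card K := by nlinarith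
        exact_mod_cast this
      rw [show (b:ℝ) * (1/d) * Nat.card K = (b * Nat.card K) / d by ring, le_div_iff₀ hdR]
      nlinarith
    · push Not at hbig
      have hex : ∃ j, b * Nat.card K ≤ 2 ^ j * d := ⟨J, hbig⟩
      obtain ⟨j, hj, hjm, hjJ⟩ : ∃ j, b * Nat.card K ≤ 2 ^ j * d ∧ (∀ m < j, 2 ^ m * d < b * Nat.card K) ∧ j ≤ J :=
        ⟨Nat.find hex, Nat.find_spec hex, fun m hm => not_le.1 (Nat.find_min hex hm), Nat.find_min' hex hbig⟩
      have hle := hH2 j K hKd hj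
      have h1 : (b:ℝ) * (1 / 2 ^ j) ≤ ∑ e ∈ outK D e0 K, (1 / d + ∑ j ∈ Finset.range (J+1), if e - e0 ∉ H j then (1:ℝ) / 2 ^ j else 0) := by
        rw [hb, ← nsmul_eq_mul]
        apply Finset.card_nsmul_le_sum
        intro e he
        rw [mem_outK] at he
        refine le_add_of_nonneg_of_le (by positivity) ?_
        have h2 : e - e0 ∉ H j := fun h => he.2 (hle h)
        have h3 := Finset.single_le_sum (f := fun j => if e - e0 ∉ H j then (1:ℝ) / 2 ^ j else 0)
          (s := Finset.range (J+1)) (fun j _ => by split_ifs <;> positivity) (Finset.mem_range.2 (by omega : j < J+1))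
        simp only [h2, not_false_eq_true, if_true] at h3
        exact h3
      refine le_trans ?_ (mul_le_mul_of_nonneg_right h1 hKp.le)
      rw [show (b:ℝ) * (1/2^j) * Nat.card K = (b * Nat.card K) / 2^j by ring, le_div_iff₀ (by positivity)]
      rcases j with _ | j
      · have : (d:ℝ) ≤ 2 * (b * Nat.card K) := by exact_mod_cast hB
        rw [pow_zero]; linarith
      · have h4 := hjm j (by omega)
        have h5 : (2:ℝ)^j * d ≤ b * Nat.card K := by exact_mod_cast h4.le
        rw [pow_succ]; linarith

end wts

section appr
variable {G : Type} [AddCommGroup G] [Fintype G] [DecidableEq G]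

noncomputable def wtf (D : Finset G) (e0 : G) (w : G → ℝ) (x y : G) : ℝ :=
  (1 / (D.card : ℝ) ^ 2) * (∑ e ∈ D, ∑ e' ∈ D, if x + (e - e') = y then (1:ℝ) else 0) +
    ∑ e ∈ D, w e * if x + (e - e0) = y then (1:ℝ) else 0

lemma dl_sum (S : Finset G) (u : G) : ∑ x ∈ S, ∑ y ∈ Sᶜ, (if x + u = y then (1:ℝ) else 0) = dl S u := by
  unfold dl
  have : ∀ x ∈ S, ∑ y ∈ Sᶜ, (if x + u = y then (1:ℝ) else 0) = if x + u ∉ S then 1 else 0 := by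
    intro x _
    rw [Finset.sum_ite_eq]; simp
  rw [Finset.sum_congr rfl this, Finset.sum_boole]

lemma cutw_wtf (D : Finset G) (e0 : G) (w : G → ℝ) (S : Finset G) :
    cutw (wtf D e0 w) S = (1 / (D.card : ℝ) ^ 2) * (∑ e ∈ D, ∑ e' ∈ D, (dl S (e - e') : ℝ)) +
      ∑ e ∈ D, w e * dl S (e - e0) := by
  unfold cutw wtf
  simp_rw [Finset.sum_add_distrib, ← Finset.mul_sum]
  congr 1
  · congr 1
    calc _ = ∑ x ∈ S, ∑ e ∈ D, ∑ e' ∈ D, ∑ y ∈ Sᶜ, (if x + (e - e') = y then (1:ℝ) else 0) := by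
          refine Finset.sum_congr rfl fun x _ => ?_
          rw [Finset.sum_comm]
          refine Finset.sum_congr rfl fun e _ => ?_
          rw [Finset.sum_comm]
      _ = ∑ e ∈ D, ∑ e' ∈ D, ∑ x ∈ S, ∑ y ∈ Sᶜ, (if x + (e - e') = y then (1:ℝ) else 0) := by
          rw [Finset.sum_comm]
          refine Finset.sum_congr rfl fun e _ => ?_
          rw [Finset.sum_comm]
      _ = _ := by simp_rw [dl_sum]
  · calc _ = ∑ x ∈ S, ∑ e ∈ D, ∑ y ∈ Sᶜ, (w e * if x + (e - e0) = y then (1:ℝ) else 0) := by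
          refine Finset.sum_congr rfl fun x _ => ?_
          rw [Finset.sum_comm]
      _ = ∑ e ∈ D, w e * ∑ x ∈ S, ∑ y ∈ Sᶜ, (if x + (e - e0) = y then (1:ℝ) else 0) := by
          rw [Finset.sum_comm]
          simp_rw [Finset.mul_sum]
      _ = _ := by simp_rw [dl_sum]

theorem cutsys (D : Finset G) (e0 : G) (he0 : e0 ∈ D) (d : ℕ) (hD : D.card = d) (hd : 0 < d) (J : ℕ) (hJ : d ≤ 2 ^ J)
    (hgen : AddSubgroup.closure ((fun e => e - e0) '' (D : Set G)) = ⊤) :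
    ∃ wt : G → G → ℝ, (∀ x y, 0 ≤ wt x y) ∧
      (∀ S : Finset G, d ≤ 2 * S.card → d ≤ 2 * Sᶜ.card → (d:ℝ) / 384 ≤ cutw wt S) ∧
      (∀ S : Finset G, cutw wt Sᶜ = cutw wt S) ∧
      (∀ (S : Finset G) (τ : ℝ), (∀ e ∈ D, ∀ e' ∈ D, (dl S (e - e') : ℝ) ≤ τ) → cutw wt S ≤ (10 + 8 * J) * τ) := by
  have hdR : (0:ℝ) < d := by exact_mod_cast hd
  obtain ⟨w, hw0, hwm, hwK⟩ := weights D e0 d hD hd J hJ hgen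
  refine ⟨wtf D e0 w, ?_, ?_, ?_, ?_⟩
  · intro x y
    unfold wtf
    refine add_nonneg (mul_nonneg (by positivity) ?_) ?_
    · refine Finset.sum_nonneg fun e _ => Finset.sum_nonneg fun e' _ => ?_
      split_ifs <;> norm_num
    · refine Finset.sum_nonneg fun e _ => mul_nonneg (hw0 e) ?_
      split_ifs <;> norm_num
  · intro S hS hSc
    rw [cutw_wtf, hD]
    set E := ∑ e ∈ D, ∑ e' ∈ D, (dl S (e - e') : ℝ) with hE
    have hE0 : 0 ≤ E := Finset.sum_nonneg fun e _ => Finset.sum_nonneg fun e' _ => Nat.cast_nonneg _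
    have hw1 : 0 ≤ ∑ e ∈ D, w e * dl S (e - e0) := Finset.sum_nonneg fun e _ => mul_nonneg (hw0 e) (Nat.cast_nonneg _)
    have hη0 : 0 ≤ 1 / (d:ℝ)^2 * E := by positivity
    by_cases h : 384 * (1 / (d:ℝ)^2 * E) ≤ d
    · obtain ⟨K, hK1, hK2, hK3⟩ := iso D S d hD hd hS hSc (1 / (d:ℝ)^2 * E) (by
        rw [← hE]; apply le_of_eq; field_simp) h
      have h1 := hwK K hK1 hK2
      have h2 : (∑ e ∈ outK D e0 K, w e) * Nat.card K ≤ 2 * ∑ e ∈ D, w e * dl S (e - e0) := by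
        rw [Finset.sum_mul, Finset.mul_sum]
        have hsub : outK D e0 K ⊆ D := fun e he => ((mem_outK _ _ _ _).1 he).1
        refine le_trans (Finset.sum_le_sum fun e he => ?_) (Finset.sum_le_sum_of_subset_of_nonneg hsub fun e _ _ => ?_)
        · have h3 := hK3 _ ((mem_outK _ _ _ _).1 he).2
          have h4 : (Nat.card K : ℝ) ≤ 2 * dl S (e - e0) := by exact_mod_cast h3
          have := mul_le_mul_of_nonneg_left h4 (hw0 e)
          linarith
        · have := mul_nonneg (hw0 e) (Nat.cast_nonneg (α := ℝ) (dl S (e - e0)))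
          linarith
      linarith
    · push Not at h
      linarith
  · intro S
    rw [cutw_wtf, cutw_wtf]
    simp_rw [dl_compl]
  · intro S τ h
    have hτ : 0 ≤ τ := le_trans (Nat.cast_nonneg _) (h e0 he0 e0 he0)
    rw [cutw_wtf, hD]
    have h1 : ∑ e ∈ D, ∑ e' ∈ D, (dl S (e - e') : ℝ) ≤ (d:ℝ)^2 * τ := by
      calc _ ≤ ∑ e ∈ D, ∑ e' ∈ D, τ := Finset.sum_le_sum fun e he => Finset.sum_le_sum fun e' he' => h e he e' he'
        _ = _ := by simp [hD]; ring
    have h2 : ∑ e ∈ D, w e * dl S (e - e0) ≤ (∑ e ∈ D, w e) * τ := by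
      rw [Finset.sum_mul]
      exact Finset.sum_le_sum fun e he => mul_le_mul_of_nonneg_left (h e he e0 he0) (hw0 e)
    have h3 : (∑ e ∈ D, w e) * τ ≤ (9 + 8 * J) * τ := mul_le_mul_of_nonneg_right hwm hτ
    have h4 : 1 / (d:ℝ)^2 * ∑ e ∈ D, ∑ e' ∈ D, (dl S (e - e') : ℝ) ≤ τ := by
      rw [one_div_mul_eq_div, div_le_iff₀ (by positivity)]; linarith
    linarith

def outD (D : Finset G) (x : G) : Finset G := D.image (fun e => x + e)
def innD (D : Finset G) (y : G) : Finset G := D.image (fun e => y - e)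

lemma mem_outD (D : Finset G) (x y : G) : y ∈ outD D x ↔ y - x ∈ D := by
  simp only [outD, Finset.mem_image]
  constructor
  · rintro ⟨e, he, rfl⟩; simpa using he
  · intro h; exact ⟨_, h, by simp⟩
lemma mem_innD (D : Finset G) (x y : G) : x ∈ innD D y ↔ y - x ∈ D := by
  simp only [innD, Finset.mem_image]
  constructor
  · rintro ⟨e, he, rfl⟩; simpa using he
  · intro h; exact ⟨_, h, by simp⟩
lemma outD_card (D : Finset G) (x : G) : (outD D x).card = D.card :=
  Finset.card_image_of_injective _ (add_right_injective x)
lemma innD_card (D : Finset G) (x : G) : (innD D x).card = D.card :=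
  Finset.card_image_of_injective _ (sub_right_injective)

lemma dl_le_t (D A : Finset G) (t : ℕ) (hA : (nbr (outD D) A).card = A.card + t) (e e' : G) (he : e ∈ D) (he' : e' ∈ D) :
    dl A (e - e') ≤ t := by
  have hsub : A.image (fun x => x + e') ⊆ nbr (outD D) A := by
    intro y hy
    obtain ⟨x, hx, rfl⟩ := Finset.mem_image.1 hy
    rw [nbr, Finset.mem_biUnion]
    exact ⟨x, hx, by rw [mem_outD]; simpa using he'⟩
  have hc : (nbr (outD D) A \ A.image (fun x => x + e')).card = t := by
    rw [Finset.card_sdiff_of_subset hsub, Finset.card_image_of_injective _ (add_left_injective e'), hA]; omega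
  rw [← hc]
  unfold dl
  apply Finset.card_le_card_of_injOn (fun x => x + e)
  · intro x hx
    simp only [Finset.coe_filter, Set.mem_setOf_eq] at hx
    rw [Finset.mem_coe, Finset.mem_sdiff]
    constructor
    · rw [nbr, Finset.mem_biUnion]
      exact ⟨x, hx.1, by rw [mem_outD]; simpa using he⟩
    · intro h
      obtain ⟨y, hy, hyx⟩ := Finset.mem_image.1 h
      apply hx.2
      have : x + (e - e') = y := by
        have : x + e = y + e' := hyx.symm
        rw [← add_sub_assoc, this]; simp
      rwa [this]
  · intro a _ c _ h; simpa using h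

/-- cells -/
lemma cells (D : Finset G) (e0 : G) (he0 : e0 ∈ D) :
    ∃ (Z : Finset G) (p : G → Z), (∀ x, ∃ e ∈ D, ∃ e' ∈ D, x = p x + (e - e')) ∧
      ∀ z : Z, D.card ≤ (Finset.univ.filter (fun x => p x = z)).card := by
  classical
  have hne : ((Finset.univ : Finset G).powerset.filter
      (fun Z => ∀ a ∈ Z, ∀ b ∈ Z, a ≠ b → Disjoint (outD D a) (outD D b))).Nonempty := ⟨∅, by simp⟩
  obtain ⟨Z, hZ, hmax⟩ := Finset.exists_max_image _ Finset.card hne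
  rw [Finset.mem_filter] at hZ
  have hcov : ∀ x, ∃ z : Z, ¬ Disjoint (outD D x) (outD D z) := by
    intro x
    by_contra hcon
    push Not at hcon
    have hxx : ¬ Disjoint (outD D x) (outD D x) := by
      rw [Finset.not_disjoint_iff]
      have : x + e0 ∈ outD D x := by rw [mem_outD]; simpa using he0
      exact ⟨_, this, this⟩
    have hxZ : x ∉ Z := fun h => hxx (hcon ⟨x, h⟩)
    have := hmax (insert x Z) (by
      rw [Finset.mem_filter]
      refine ⟨by simp, ?_⟩
      intro a ha b hb hab
      rw [Finset.mem_insert] at ha hb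
      rcases ha with rfl | ha <;> rcases hb with rfl | hb
      · exact absurd rfl hab
      · exact hcon ⟨b, hb⟩
      · exact (hcon ⟨a, ha⟩).symm
      · exact hZ.2 a ha b hb hab)
    rw [Finset.card_insert_of_notMem hxZ] at this
    omega
  have hp : ∀ x, ∃ z : Z, ¬ Disjoint (outD D x) (outD D z) ∧ ∀ z' : Z, x + e0 ∈ outD D z' → z = z' := by
    intro x
    by_cases h : ∃ z' : Z, x + e0 ∈ outD D z'
    · obtain ⟨z', hz'⟩ := h
      refine ⟨z', ?_, ?_⟩
      · rw [Finset.not_disjoint_iff]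
        exact ⟨x + e0, by rw [mem_outD]; simpa using he0, hz'⟩
      · intro z'' hz''
        by_contra hne
        have := hZ.2 z' z'.2 z'' z''.2 (fun h => hne (Subtype.ext h))
        exact Finset.disjoint_left.1 this hz' hz''
    · obtain ⟨z, hz⟩ := hcov x
      exact ⟨z, hz, fun z' hz' => absurd ⟨z', hz'⟩ h⟩
  choose p hp1 hp2 using hp
  refine ⟨Z, p, ?_, ?_⟩
  · intro x
    have := hp1 x
    rw [Finset.not_disjoint_iff] at this
    obtain ⟨y, h1, h2⟩ := this
    rw [mem_outD] at h1 h2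
    exact ⟨_, h2, _, h1, by abel⟩
  · intro z
    apply Finset.card_le_card_of_injOn (fun e => (z:G) + e - e0)
    · intro e he
      simp only [Finset.coe_filter, Set.mem_setOf_eq, Finset.mem_univ, true_and]
      apply hp2
      rw [mem_outD]; simpa using he
    · intro a _ c _ h; simpa using h

lemma dl_shift (A : Finset G) (s u : G) : dl (Finset.univ.filter (fun x => x + s ∈ A)) u = dl A u := by
  unfold dl
  apply Finset.card_bij (fun x _ => x + s)
  · intro x hx
    simp at hx ⊢
    refine ⟨hx.1, ?_⟩
    rw [show x + s + u = x + u + s by abel]; exact hx.2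
  · intro a _ c _ h; simpa using h
  · intro y hy
    simp at hy
    refine ⟨y - s, ?_, by simp⟩
    simp
    refine ⟨hy.1, ?_⟩
    rw [show y - s + u + s = y + u by abel]; exact hy.2

lemma symm_count (A : Finset G) (u : G) :
    (Finset.univ.filter (fun y => ¬ (y + u ∈ A ↔ y ∈ A))).card ≤ 2 * dl A u := by
  have h : Finset.univ.filter (fun y => ¬ (y + u ∈ A ↔ y ∈ A)) ⊆
      A.filter (fun x => x + u ∉ A) ∪ Aᶜ.filter (fun x => x + u ∉ Aᶜ) := by
    intro y hy
    simp at hy ⊢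
    tauto
  have h1 := (Finset.card_le_card h).trans (Finset.card_union_le _ _)
  have h2 := dl_compl A u
  unfold dl at *
  omega

lemma approx_one (D : Finset G) (e0 : G) (Z : Finset G) (p : G → Z)
    (hp : ∀ x, ∃ e ∈ D, ∃ e' ∈ D, x = p x + (e - e')) (A : Finset G) (t : ℕ)
    (hA : ∀ e ∈ D, ∀ e' ∈ D, dl A (e - e') ≤ t) :
    ∃ s : G, ((Finset.univ.filter (fun x => ¬ (x + s ∈ A ↔ (p x : G) + s ∈ A))).card) ≤ 2 * t := by
  by_contra hcon
  simp only [not_exists, not_le] at hcon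
  have h1 : ∑ s : G, (Finset.univ.filter (fun x => ¬ (x + s ∈ A ↔ (p x : G) + s ∈ A))).card
      = ∑ x : G, (Finset.univ.filter (fun s => ¬ (x + s ∈ A ↔ (p x : G) + s ∈ A))).card := by
    exact Finset.sum_card_bipartiteAbove_eq_sum_card_bipartiteBelow (s := Finset.univ) (t := Finset.univ)
      (fun s x => ¬ (x + s ∈ A ↔ (p x : G) + s ∈ A))
  have h2 : ∀ x : G, (Finset.univ.filter (fun s => ¬ (x + s ∈ A ↔ (p x : G) + s ∈ A))).card ≤ 2 * t := by
    intro x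
    obtain ⟨e, he, e', he', hx⟩ := hp x
    refine le_trans ?_ (Nat.mul_le_mul_left 2 (hA e he e' he'))
    refine le_trans ?_ (symm_count A (e - e'))
    apply Finset.card_le_card_of_injOn (fun s => (p x : G) + s)
    · intro s hs
      simp only [Finset.coe_filter, Set.mem_setOf_eq, Finset.mem_univ, true_and] at hs ⊢
      rwa [show (p x : G) + s + (e - e') = x + s by conv_rhs => rw [hx]
                                                    abel]
    · intro a _ c _ h; simpa using h
  have h3 : ∑ s : G, 2 * t < ∑ s : G, (Finset.univ.filter (fun x => ¬ (x + s ∈ A ↔ (p x : G) + s ∈ A))).card :=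
    Finset.sum_lt_sum_of_nonempty ⟨0, Finset.mem_univ _⟩ (fun s _ => hcon s)
  rw [h1] at h3
  have h4 := Finset.sum_le_sum (s := Finset.univ) (fun x _ => h2 x)
  exact absurd h3 (not_lt.2 h4)

theorem approx_family (D : Finset G) (e0 : G) (he0 : e0 ∈ D) (d : ℕ) (hD : D.card = d) (hd : 0 < d) (J : ℕ) (hJ : d ≤ 2 ^ J)
    (hgen : AddSubgroup.closure ((fun e => e - e0) '' (D : Set G)) = ⊤) (t r : ℕ) (hr : 1 ≤ r)
    (htr : 2304 * (10 + 8 * J) * t ≤ r * d) :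
    ∃ 𝓕 : Finset (Finset G), 𝓕.card ≤ Fintype.card G * (2 * Fintype.card G) ^ r ∧
      ∀ A : Finset G, (nbr (outD D) A).card = A.card + t → ∃ A0 ∈ 𝓕, (A \ A0).card + (A0 \ A).card ≤ 2 * t := by
  classical
  obtain ⟨wt, hw0, hwlow, hwc, hwup⟩ := cutsys D e0 he0 d hD hd J hJ hgen
  obtain ⟨Z, p, hp1, hp2⟩ := cells D e0 he0
  have hN : 1 ≤ Fintype.card G := Fintype.card_pos
  have hK := karger' wt hw0 ((d:ℝ)/384) (by positivity) r hr Z p (Fintype.card G) hN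
    (by rw [Fintype.card_coe]; exact Finset.card_le_univ Z) (by
      have hcell : ∀ S : Finset Z, S.Nonempty → d ≤ (preS p S).card := by
        rintro S ⟨z, hz⟩
        rw [← hD]
        refine (hp2 z).trans (Finset.card_le_card ?_)
        intro x hx
        simp [preS] at hx ⊢
        rwa [hx]
      intro S h1 h2
      apply hwlow
      · have := hcell S h1; omega
      · rw [← preS_compl]
        have := hcell Sᶜ (by
          rw [Finset.nonempty_iff_ne_empty]; intro h; apply h2
          rwa [Finset.compl_eq_empty_iff] at h)
        omega)
  set 𝓤 := Finset.univ.filter (fun S : Finset Z => cutw wt (preS p S) + cutw wt (preS p Sᶜ) ≤ r*((d:ℝ)/384)) with h𝓤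
  refine ⟨(Finset.univ ×ˢ 𝓤).image (fun q : G × Finset Z => Finset.univ.filter (fun x => p (x - q.1) ∈ q.2)), ?_, ?_⟩
  · refine Finset.card_image_le.trans ?_
    rw [Finset.card_product, Finset.card_univ]
    exact Nat.mul_le_mul_left _ hK
  · intro A hA
    have hdl := dl_le_t D A t hA
    obtain ⟨s, hs⟩ := approx_one D e0 Z p hp1 A t (fun e he e' he' => hdl e e' he he')
    set U : Finset Z := Finset.univ.filter (fun z => (z:G) + s ∈ A) with hU
    have hmU : ∀ x, p x ∈ U ↔ (p x : G) + s ∈ A := by intro x; simp [hU]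
    have hUm : U ∈ 𝓤 := by
      rw [h𝓤, Finset.mem_filter]
      refine ⟨Finset.mem_univ _, ?_⟩
      rw [preS_compl, hwc]
      have h1 : cutw wt (preS p U) ≤ (10 + 8 * J) * (3 * t : ℝ) := by
        apply hwup
        intro e he e' he'
        have h2 := dl_approx (Finset.univ.filter (fun x => x + s ∈ A)) (preS p U) (e - e')
        rw [dl_shift] at h2
        have h3 := hdl e e' he he'
        have h4 : (preS p U \ Finset.univ.filter (fun x => x + s ∈ A)).card + (Finset.univ.filter (fun x => x + s ∈ A) \ preS p U).card ≤ 2 * t := by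
          refine le_trans ?_ hs
          rw [← Finset.card_union_of_disjoint]
          · apply Finset.card_le_card
            intro x hx
            simp [preS, hmU] at hx ⊢
            tauto
          · rw [Finset.disjoint_left]; intro a; simp; tauto
        have h5 : dl (preS p U) (e - e') ≤ 3 * t := by omega
        exact_mod_cast h5
      have h2 : (2304 * (10 + 8 * J) * t : ℝ) ≤ r * d := by exact_mod_cast htr
      linarith
    refine ⟨_, Finset.mem_image.2 ⟨(s, U), by simp [hUm], rfl⟩, ?_⟩
    refine le_trans ?_ hs
    rw [← Finset.card_union_of_disjoint]
    · apply Finset.card_le_card_of_injOn (fun x => x - s)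
      · intro x hx
        simp [hmU] at hx ⊢
        tauto
      · intro a _ c _ h; simpa using h
    · rw [Finset.disjoint_left]; intro a; simp; tauto

theorem t_lower (D : Finset G) (e0 : G) (he0 : e0 ∈ D) (d : ℕ) (hD : D.card = d) (hd : 0 < d) (J : ℕ) (hJ : d ≤ 2 ^ J)
    (hgen : AddSubgroup.closure ((fun e => e - e0) '' (D : Set G)) = ⊤) (t : ℕ) (A : Finset G)
    (hA : (nbr (outD D) A).card = A.card + t) (hne : A.Nonempty) (hA2 : 2 * A.card ≤ Fintype.card G) :
    d ≤ 384 * (10 + 8 * J) * t := by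
  obtain ⟨wt, hw0, hwlow, hwc, hwup⟩ := cutsys D e0 he0 d hD hd J hJ hgen
  by_cases h : d ≤ 2 * A.card
  · have h1 := hwlow A h (by
      rw [Finset.card_compl]
      have := Finset.card_le_univ D
      omega)
    have h2 := hwup A t (fun e he e' he' => by exact_mod_cast dl_le_t D A t hA e e' he he')
    have : (d:ℝ) ≤ 384 * (10 + 8 * J) * t := by linarith
    exact_mod_cast this
  · obtain ⟨a, ha⟩ := hne
    have : d ≤ (nbr (outD D) A).card := by
      rw [← hD, ← outD_card D a]
      exact Finset.card_le_card (Finset.subset_biUnion_of_mem _ ha)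
    have h2 : d ≤ 2 * t := by omega
    nlinarith [Nat.zero_le (J * t)]

end appr

section asm
variable {G : Type} [AddCommGroup G] [Fintype G] [DecidableEq G]

lemma small_finsets (k : ℕ) :
    (Finset.univ.filter (fun X : Finset G => X.card ≤ k)).card ≤ (Fintype.card G + 1) ^ k := by
  classical
  have h : Fintype.card (Fin k → Option G) = (Fintype.card G + 1) ^ k := by simp
  rw [← h, ← Finset.card_univ]
  apply Finset.card_le_card_of_surjOn (fun f => Finset.univ.filter (fun x => ∃ i, f i = some x))
  intro X hX
  simp only [Finset.coe_filter, Set.mem_setOf_eq, Finset.mem_univ, true_and] at hX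
  rw [Set.mem_image]
  refine ⟨fun i => (X.toList)[(i:ℕ)]?, by simp, ?_⟩
  ext x
  simp only [Finset.mem_filter, Finset.mem_univ, true_and]
  rw [← Finset.mem_toList, List.mem_iff_getElem?]
  constructor
  · rintro ⟨i, hi⟩; exact ⟨i, hi⟩
  · rintro ⟨i, hi⟩
    have : i < X.toList.length := (List.getElem?_eq_some_iff.1 hi).1
    rw [Finset.length_toList] at this
    exact ⟨⟨i, by omega⟩, hi⟩

lemma hc2_check (d J ψ t q : ℕ) (hd : 0 < d) (hJ : d ≤ 2 ^ J) (hJ2 : 2 ≤ J) (hψ : ψ * (64 * J) ≤ d)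
    (hq : (q:ℝ) ≤ t / (4 * J) + 1) (ht : 2 * J ≤ t) :
    (1 + (1:ℝ) / 2 ^ J) ^ (8 * ψ * t) ≤ ((1:ℝ) / 2 ^ J) ^ q * (2:ℝ) ^ ((1 - 1 / (8 * J : ℝ)) * t) := by
  have hJR : (2:ℝ) ≤ J := by exact_mod_cast hJ2
  have htR : (2:ℝ) * J ≤ t := by exact_mod_cast ht
  have hψR : (ψ:ℝ) * (64 * J) ≤ d := by exact_mod_cast hψ
  have hJd : (d:ℝ) ≤ 2 ^ J := by exact_mod_cast hJ
  have hdR : (0:ℝ) < d := by exact_mod_cast hd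
  have h1 : (1 + (1:ℝ) / 2 ^ J) ^ (8 * ψ * t) ≤ (2:ℝ) ^ ((t:ℝ) / 8) := by
    have e1 : 1 + (1:ℝ) / 2 ^ J ≤ Real.exp (1 / d) := by
      have : (1:ℝ) / 2 ^ J ≤ 1 / d := one_div_le_one_div_of_le hdR hJd
      have := Real.add_one_le_exp ((1:ℝ)/d)
      linarith
    have e2 : (1 + (1:ℝ) / 2 ^ J) ^ (8 * ψ * t) ≤ Real.exp (1 / d) ^ (8 * ψ * t) :=
      pow_le_pow_left₀ (by positivity) e1 _
    refine e2.trans ?_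
    rw [← Real.exp_nat_mul, Real.rpow_def_of_pos (by norm_num)]
    apply Real.exp_le_exp.2
    have hl : (1:ℝ)/2 ≤ Real.log 2 := by have := Real.log_two_gt_d9; linarith
    have h3 : (8 * ψ * t : ℝ) * (1/d) ≤ t / 16 := by
      rw [mul_one_div, div_le_iff₀ hdR]
      have h4 : (ψ:ℝ) * 128 ≤ d := by nlinarith [Nat.cast_nonneg (α := ℝ) ψ]
      nlinarith [Nat.cast_nonneg (α := ℝ) t]
    push_cast
    refine h3.trans ?_
    nlinarith [Nat.cast_nonneg (α := ℝ) t]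
  refine h1.trans ?_
  have h2 : ((1:ℝ) / 2 ^ J) ^ q = (2:ℝ) ^ (-(J * q : ℝ)) := by
    rw [Real.rpow_neg (by norm_num), one_div, inv_pow, ← pow_mul]
    congr 1
    rw [← Real.rpow_natCast]; push_cast; rfl
  rw [h2, ← Real.rpow_add (by norm_num)]
  apply Real.rpow_le_rpow_of_exponent_le (by norm_num)
  have h5 : (J:ℝ) * q ≤ t / 4 + J := by
    have := mul_le_mul_of_nonneg_left hq (by positivity : (0:ℝ) ≤ J)
    have e : (J:ℝ) * (t / (4 * J) + 1) = t / 4 + J := by field_simp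
    linarith
  have h6 : 1 / (8 * J : ℝ) ≤ 1 / 8 := one_div_le_one_div_of_le (by norm_num) (by linarith)
  have h7 : (1 / (8 * J : ℝ)) * t ≤ 1/8 * t := mul_le_mul_of_nonneg_right h6 (Nat.cast_nonneg _)
  nlinarith

open Classical in
set_option maxHeartbeats 1600000 in
theorem fixed_tg (D : Finset G) (e0 : G) (he0 : e0 ∈ D) (d : ℕ) (hD : D.card = d) (J ℓ : ℕ) (hJ : d ≤ 2 ^ J)
    (hJ2 : 2 ≤ J) (hℓ : 2 * Fintype.card G ≤ 2 ^ ℓ)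
    (hbig : 1000000 * J ^ 2 * ℓ ≤ d)
    (hgen : AddSubgroup.closure ((fun e => e - e0) '' (D : Set G)) = ⊤) (t g : ℕ) :
    ((Finset.univ.filter (fun P : Finset G => P.Nonempty ∧ 2 * (clo (outD D) P).card ≤ Fintype.card G ∧
      (nbr (outD D) P).card = g ∧ (nbr (outD D) P).card = (clo (outD D) P).card + t)).card : ℝ)
      ≤ (2:ℝ) ^ (g : ℝ) / 2 ^ (4 * ℓ) := by
  have hN : 1 ≤ Fintype.card G := Fintype.card_pos
  have hℓ1 : 1 ≤ ℓ := by
    rcases ℓ with _ | ℓ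
    · simp at hℓ; omega
    · omega
  have hd : 0 < d := by
    have : 0 < 1000000 * J ^ 2 * ℓ := by positivity
    omega
  rcases Finset.eq_empty_or_nonempty (Finset.univ.filter (fun P : Finset G => P.Nonempty ∧ 2 * (clo (outD D) P).card ≤ Fintype.card G ∧
      (nbr (outD D) P).card = g ∧ (nbr (outD D) P).card = (clo (outD D) P).card + t)) with hE | ⟨P0, hP0⟩
  · rw [hE]; simp; positivity
  simp only [Finset.mem_filter, Finset.mem_univ, true_and] at hP0
  have htl : d ≤ 384 * (10 + 8 * J) * t := by
    refine t_lower D e0 he0 d hD hd J hJ hgen t (clo (outD D) P0) ?_ ?_ hP0.2.1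
    · rw [nbr_clo]; exact hP0.2.2.2
    · exact hP0.1.mono (subset_clo _ _)
  have htl2 : d ≤ 6912 * J * t := by
    refine htl.trans ?_
    apply Nat.mul_le_mul_right
    omega
  have ht2 : 2 * J ≤ t := by
    by_contra h
    push Not at h
    have h1 : 6912 * J * t ≤ 6912 * J * (2 * J) := Nat.mul_le_mul_left _ h.le
    have h2 : 1000000 * J^2 ≤ 1000000 * J ^ 2 * ℓ := Nat.le_mul_of_pos_right _ hℓ1
    have h3 : 0 < J^2 := by positivity
    nlinarith
  set ψ := d / (64 * J) with hψ
  have hJR : (2:ℝ) ≤ J := by exact_mod_cast hJ2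
  have hdR : (0:ℝ) < d := by exact_mod_cast hd
  have hψ1 : ψ * (64 * J) ≤ d := Nat.div_mul_le_self _ _
  have hψ2 : d ≤ ψ * (128 * J) := by
    have h1 : 1 ≤ ψ := by
      rw [hψ, Nat.one_le_div_iff (by positivity)]
      have : 1000000 * J^2 ≤ 1000000 * J ^ 2 * ℓ := Nat.le_mul_of_pos_right _ hℓ1
      nlinarith
    have h2 : d < (ψ + 1) * (64 * J) := by
      rw [hψ]; rw [mul_comm]; exact Nat.lt_mul_div_succ d (by positivity)
    nlinarith
  have hψpos : 0 < ψ := by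
    rcases Nat.eq_zero_or_pos ψ with h | h
    · rw [h] at hψ2; omega
    · exact h
  have h2ψ : 2 * ψ ≤ d := by nlinarith
  set r := 2304 * (10 + 8 * J) * t / d + 1 with hr
  set k := 6 * t / ψ with hk
  obtain ⟨𝓕, h𝓕c, h𝓕⟩ := approx_family D e0 he0 d hD hd J hJ hgen t r (Nat.le_add_left 1 _) (by
    rw [hr, mul_comm _ d]; exact (Nat.lt_mul_div_succ _ hd).le)
  have hio : ∀ x y : G, x ∈ innD D y ↔ y ∈ outD D x := fun x y => by rw [mem_innD, mem_outD]
  have ho : ∀ x : G, (outD D x).card = d := fun x => by rw [outD_card, hD]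
  have hi : ∀ x : G, (innD D x).card = d := fun x => by rw [innD_card, hD]
  set q := ⌈(t:ℝ) / (4 * J)⌉₊ with hq
  have hq1 : (t:ℝ) / (4*J) ≤ q := Nat.le_ceil _
  have hq2 : (q:ℝ) ≤ t / (4*J) + 1 := (Nat.ceil_lt_add_one (by positivity)).le
  set sm := Finset.univ.filter (fun X : Finset G => X.card ≤ k) with hsm
  have hsmc : sm.card ≤ (Fintype.card G + 1) ^ k := small_finsets k
  set codes := 𝓕 ×ˢ (sm ×ˢ (sm ×ˢ sm)) with hcodes
  let Fn : Finset G → Finset G := fun A0 => A0.image (fun x => x + e0)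
  let fam : Finset G × Finset G × Finset G × Finset G → Finset (Finset G) := fun c =>
    Finset.univ.filter (fun P : Finset G => GoodC (outD D) (innD D) (clo (outD D) P)
      (cS (outD D) (innD D) ψ (Fn c.1) c.2.1 c.2.2.1 c.2.2.2) (cM (outD D) (innD D) ψ (Fn c.1) c.2.1 c.2.2.1 c.2.2.2) t ψ ∧
      (nbr (outD D) P).card = g ∧ (nbr (outD D) P).card = (clo (outD D) P).card + t)
  have hfam : ∀ c, ((fam c).card : ℝ) ≤ (2:ℝ) ^ (g - 1 / (8 * J : ℝ) * t : ℝ) := by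
    intro c
    apply count_container (outD D) (innD D) hio d ho hi hd _ _ t ψ g q (1 / (8 * J : ℝ)) (1 / 2 ^ J) (by positivity)
      (by rw [div_le_one (by positivity)]; exact one_le_pow₀ (by norm_num))
    · refine le_trans ?_ hq1
      have h1 : (8 * ψ * t : ℝ) / d ≤ t / (8 * J) := by
        rw [div_le_div_iff₀ hdR (by positivity)]
        have : (ψ:ℝ) * (64 * J) ≤ d := by exact_mod_cast hψ1
        nlinarith [Nat.cast_nonneg (α := ℝ) t]
      have h2 : (t:ℝ) / (4 * J) = t / (8 * J) + 1 / (8 * J) * t := by field_simp; ring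
      linarith
    · exact hc2_check d J ψ t q hd hJ hJ2 hψ1 hq2 ht2
  have hsub : Finset.univ.filter (fun P : Finset G => P.Nonempty ∧ 2 * (clo (outD D) P).card ≤ Fintype.card G ∧
      (nbr (outD D) P).card = g ∧ (nbr (outD D) P).card = (clo (outD D) P).card + t) ⊆ codes.biUnion fam := by
    intro P hP
    simp only [Finset.mem_filter, Finset.mem_univ, true_and] at hP
    obtain ⟨_, _, hP3, hP4⟩ := hP
    set A := clo (outD D) P with hA
    have hAt : (nbr (outD D) A).card = A.card + t := by rw [hA, nbr_clo]; exact hP4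
    obtain ⟨A0, hA0, hA0d⟩ := h𝓕 A hAt
    have hsubA : A.image (fun x => x + e0) ⊆ nbr (outD D) A := by
      intro y hy
      obtain ⟨x, hx, rfl⟩ := Finset.mem_image.1 hy
      rw [nbr, Finset.mem_biUnion]
      exact ⟨x, hx, by rw [mem_outD]; simpa using he0⟩
    have hinj : Function.Injective (fun x : G => x + e0) := add_left_injective e0
    obtain ⟨X1, Y1, X2, hX1, hY1, hX2, hgood⟩ := container (outD D) (innD D) hio d ho hi A t ψ hd h2ψ hAt (Fn A0)
      (by
        have h1 : (nbr (outD D) A \ A.image (fun x => x + e0)).card = t := by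
          rw [Finset.card_sdiff_of_subset hsubA, Finset.card_image_of_injective _ hinj, hAt]; omega
        have h2 : nbr (outD D) A \ Fn A0 ⊆ (nbr (outD D) A \ A.image (fun x => x + e0)) ∪ (A \ A0).image (fun x => x + e0) := by
          rw [Finset.image_sdiff _ _ hinj]
          intro y
          simp only [Finset.mem_sdiff, Finset.mem_union, Fn]
          tauto
        have h3 := (Finset.card_le_card h2).trans (Finset.card_union_le _ _)
        rw [Finset.card_image_of_injective _ hinj] at h3
        omega)
      (by
        have h2 : Fn A0 \ nbr (outD D) A ⊆ (A0 \ A).image (fun x => x + e0) := by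
          rw [Finset.image_sdiff _ _ hinj]
          intro y
          simp only [Finset.mem_sdiff, Fn]
          exact fun h => ⟨h.1, fun h' => h.2 (hsubA h')⟩
        have h3 := (Finset.card_le_card h2)
        rw [Finset.card_image_of_injective _ hinj] at h3
        omega)
    rw [Finset.mem_biUnion]
    refine ⟨(A0, X1, Y1, X2), ?_, ?_⟩
    · simp only [hcodes, Finset.mem_product, hsm, Finset.mem_filter, Finset.mem_univ, true_and]
      refine ⟨hA0, ?_, ?_, ?_⟩
      · exact (Nat.le_div_iff_mul_le hψpos).2 hX1
      · exact (Nat.le_div_iff_mul_le hψpos).2 hY1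
      · exact (Nat.le_div_iff_mul_le hψpos).2 hX2
    · simp only [fam, Finset.mem_filter, Finset.mem_univ, true_and]
      exact ⟨hgood, hP3, hP4⟩
  have hcc : codes.card ≤ (2 ^ ℓ) ^ (1 + r + 3 * k) := by
    rw [hcodes, Finset.card_product, Finset.card_product, Finset.card_product]
    have a1 : 𝓕.card ≤ (2^ℓ) * (2^ℓ)^r := h𝓕c.trans (Nat.mul_le_mul (by omega) (Nat.pow_le_pow_left hℓ _))
    have a2 : sm.card ≤ (2^ℓ)^k := hsmc.trans (Nat.pow_le_pow_left (by omega) _)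
    calc _ ≤ ((2^ℓ) * (2^ℓ)^r) * ((2^ℓ)^k * ((2^ℓ)^k * (2^ℓ)^k)) := by gcongr
      _ = _ := by rw [pow_add, pow_add, pow_one]; ring
  have hfin : ((Finset.univ.filter (fun P : Finset G => P.Nonempty ∧ 2 * (clo (outD D) P).card ≤ Fintype.card G ∧
      (nbr (outD D) P).card = g ∧ (nbr (outD D) P).card = (clo (outD D) P).card + t)).card : ℝ)
      ≤ codes.card * (2:ℝ) ^ (g - 1 / (8 * J : ℝ) * t : ℝ) := by
    calc _ ≤ ((codes.biUnion fam).card : ℝ) := by exact_mod_cast Finset.card_le_card hsub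
      _ ≤ ∑ c ∈ codes, ((fam c).card : ℝ) := by exact_mod_cast Finset.card_biUnion_le
      _ ≤ ∑ c ∈ codes, (2:ℝ) ^ (g - 1 / (8 * J : ℝ) * t : ℝ) := Finset.sum_le_sum fun c _ => hfam c
      _ = _ := by simp
  refine hfin.trans ?_
  have hcc' : (codes.card : ℝ) ≤ (2:ℝ) ^ ((ℓ * (1 + r + 3 * k) : ℕ) : ℝ) := by
    rw [Real.rpow_natCast, pow_mul]; exact_mod_cast hcc
  rw [le_div_iff₀ (by positivity)]
  calc codes.card * (2:ℝ) ^ (g - 1 / (8 * J : ℝ) * t : ℝ) * 2 ^ (4 * ℓ)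
      ≤ (2:ℝ) ^ ((ℓ * (1 + r + 3 * k) : ℕ) : ℝ) * (2:ℝ) ^ (g - 1 / (8 * J : ℝ) * t : ℝ) * (2:ℝ) ^ ((4 * ℓ : ℕ) : ℝ) := by
        rw [Real.rpow_natCast 2 (4 * ℓ)]; gcongr
    _ = (2:ℝ) ^ (((ℓ * (1 + r + 3 * k) : ℕ) : ℝ) + (g - 1 / (8 * J : ℝ) * t) + ((4 * ℓ : ℕ) : ℝ)) := by
        rw [Real.rpow_add (by norm_num), Real.rpow_add (by norm_num)]
    _ ≤ (2:ℝ) ^ (g:ℝ) := by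
        apply Real.rpow_le_rpow_of_exponent_le (by norm_num)
        push_cast
        -- x = J t / d
        have hx : (1:ℝ) ≤ 6912 * (J * t / d) := by
          rw [← mul_div_assoc, le_div_iff₀ hdR]
          have : (d:ℝ) ≤ 6912 * J * t := by exact_mod_cast htl2
          linarith
        have hr1 : (r:ℝ) ≤ 41472 * (J * t / d) + 1 := by
          rw [hr]; push_cast
          have h1 : (((2304 * (10 + 8 * J) * t / d : ℕ)) : ℝ) ≤ ((2304 * (10 + 8 * J) * t : ℕ) : ℝ) / d := Nat.cast_div_le
          have h2 : ((2304 * (10 + 8 * J) * t : ℕ) : ℝ) / d ≤ 41472 * (J * t / d) := by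
            rw [← mul_div_assoc, div_le_div_iff_of_pos_right hdR]
            push_cast
            have : (2304 * (10 + 8 * J) : ℝ) ≤ 41472 * J := by linarith
            nlinarith [Nat.cast_nonneg (α := ℝ) t]
          linarith
        have hk1 : (3 * k:ℝ) ≤ 2304 * (J * t / d) := by
          have h1 : (k:ℝ) ≤ ((6 * t : ℕ) : ℝ) / ψ := Nat.cast_div_le
          have hψR : (0:ℝ) < ψ := by exact_mod_cast hψpos
          have h2 : ((6 * t : ℕ) : ℝ) / ψ ≤ 768 * (J * t / d) := by
            rw [← mul_div_assoc, div_le_div_iff₀ hψR hdR]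
            have : (d:ℝ) ≤ ψ * (128 * J) := by exact_mod_cast hψ2
            push_cast
            nlinarith [Nat.cast_nonneg (α := ℝ) t]
          linarith
        have hmain : (ℓ:ℝ) * (5 + r + 3 * k) ≤ 1 / (8 * J) * t := by
          have h1 : (5 + r + 3 * k : ℝ) ≤ 125000 * (J * t / d) := by linarith
          have hbR : (1000000 * J ^ 2 * ℓ : ℝ) ≤ d := by exact_mod_cast hbig
          calc (ℓ:ℝ) * (5 + r + 3 * k) ≤ ℓ * (125000 * (J * t / d)) := by gcongr
            _ = (1000000 * J ^ 2 * ℓ) * (t / (8 * J * d)) := by field_simp; ring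
            _ ≤ d * (t / (8 * J * d)) := by gcongr
            _ = _ := by field_simp
        nlinarith

end asm

section bip
variable {G : Type} [AddCommGroup G] [Fintype G] [DecidableEq G]

lemma card_le_nbr (D : Finset G) (e0 : G) (he0 : e0 ∈ D) (A : Finset G) : A.card ≤ (nbr (outD D) A).card := by
  rw [← Finset.card_image_of_injective A (add_left_injective e0)]
  apply Finset.card_le_card
  intro y hy
  obtain ⟨x, hx, rfl⟩ := Finset.mem_image.1 hy
  rw [nbr, Finset.mem_biUnion]
  exact ⟨x, hx, by rw [mem_outD]; simpa using he0⟩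

open Classical in
theorem T_bound (D : Finset G) (e0 : G) (he0 : e0 ∈ D) (d : ℕ) (hD : D.card = d) (J ℓ : ℕ) (hJ : d ≤ 2 ^ J)
    (hJ2 : 2 ≤ J) (hℓ : 2 * Fintype.card G ≤ 2 ^ ℓ)
    (hbig : 1000000 * J ^ 2 * ℓ ≤ d)
    (hgen : AddSubgroup.closure ((fun e => e - e0) '' (D : Set G)) = ⊤) :
    (∑ P ∈ Finset.univ.filter (fun P : Finset G => 2 * (clo (outD D) P).card ≤ Fintype.card G),
      (2:ℝ) ^ (Fintype.card G - (nbr (outD D) P).card)) ≤ 2 ^ Fintype.card G * (1 + 1 / Fintype.card G) := by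
  set N := Fintype.card G with hN
  have hN1 : 1 ≤ N := Fintype.card_pos
  set 𝒜 := Finset.univ.filter (fun P : Finset G => 2 * (clo (outD D) P).card ≤ N) with h𝒜
  have hterm : ∀ P : Finset G, (2:ℝ) ^ (N - (nbr (outD D) P).card) = 2 ^ N * (1 / 2 ^ (nbr (outD D) P).card) := by
    intro P
    have : (nbr (outD D) P).card ≤ N := Finset.card_le_univ _
    rw [mul_one_div, pow_sub₀ _ (by norm_num) this, div_eq_mul_inv]
  simp_rw [hterm]
  rw [← Finset.mul_sum]
  apply mul_le_mul_of_nonneg_left _ (by positivity)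
  set I := Finset.range (N+1) ×ˢ Finset.range (N+1) with hI
  let fam : ℕ × ℕ → Finset (Finset G) := fun c => Finset.univ.filter (fun P : Finset G => P.Nonempty ∧ 2 * (clo (outD D) P).card ≤ N ∧
      (nbr (outD D) P).card = c.2 ∧ (nbr (outD D) P).card = (clo (outD D) P).card + c.1)
  have hsub : 𝒜 ⊆ {∅} ∪ I.biUnion fam := by
    intro P hP
    rw [Finset.mem_union, Finset.mem_singleton, Finset.mem_biUnion]
    rcases Finset.eq_empty_or_nonempty P with h | h
    · left; exact h
    · right
      simp only [h𝒜, Finset.mem_filter, Finset.mem_univ, true_and] at hP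
      have h1 : (clo (outD D) P).card ≤ (nbr (outD D) P).card := by
        rw [← nbr_clo]; exact card_le_nbr D e0 he0 _
      have h2 : (nbr (outD D) P).card ≤ N := Finset.card_le_univ _
      refine ⟨((nbr (outD D) P).card - (clo (outD D) P).card, (nbr (outD D) P).card), ?_, ?_⟩
      · simp [hI]; omega
      · simp only [fam, Finset.mem_filter, Finset.mem_univ, true_and]
        refine ⟨h, hP, by omega⟩
  have hpos : ∀ P : Finset G, (0:ℝ) ≤ 1 / 2 ^ (nbr (outD D) P).card := fun P => by positivity
  calc ∑ P ∈ 𝒜, (1:ℝ) / 2 ^ (nbr (outD D) P).card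
      ≤ ∑ P ∈ {∅} ∪ I.biUnion fam, (1:ℝ) / 2 ^ (nbr (outD D) P).card :=
        Finset.sum_le_sum_of_subset_of_nonneg hsub (fun P _ _ => hpos P)
    _ ≤ ∑ P ∈ {∅}, (1:ℝ) / 2 ^ (nbr (outD D) P).card + ∑ P ∈ I.biUnion fam, (1:ℝ) / 2 ^ (nbr (outD D) P).card := by
        rw [← Finset.sum_union_inter]
        exact le_add_of_nonneg_right (Finset.sum_nonneg fun P _ => hpos P)
    _ ≤ 1 + ∑ c ∈ I, ∑ P ∈ fam c, (1:ℝ) / 2 ^ (nbr (outD D) P).card := by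
        apply add_le_add
        · simp [nbr]
        · apply le_of_eq
          apply Finset.sum_biUnion
          intro a _ b _ hab
          rw [Function.onFun, Finset.disjoint_left]
          intro P h1 h2
          simp only [fam, Finset.mem_filter, Finset.mem_univ, true_and] at h1 h2
          apply hab
          ext <;> omega
    _ ≤ 1 + ∑ c ∈ I, 1 / 2 ^ (4 * ℓ) := by
        apply add_le_add_right
        apply Finset.sum_le_sum
        intro c _
        have h1 : ∑ P ∈ fam c, (1:ℝ) / 2 ^ (nbr (outD D) P).card = (fam c).card * (1 / 2 ^ c.2) := by
          rw [← nsmul_eq_mul, ← Finset.sum_const]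
          refine Finset.sum_congr rfl fun P hP => ?_
          simp only [fam, Finset.mem_filter, Finset.mem_univ, true_and] at hP
          rw [hP.2.2.1]
        have h2 := fixed_tg D e0 he0 d hD J ℓ hJ hJ2 hℓ hbig hgen c.1 c.2
        rw [Real.rpow_natCast] at h2
        rw [h1, mul_one_div, div_le_iff₀ (by positivity), one_div_mul_eq_div]
        exact h2
    _ ≤ 1 + 1 / N := by
        apply add_le_add_right
        rw [Finset.sum_const, hI, Finset.card_product, Finset.card_range, nsmul_eq_mul, mul_one_div,
          div_le_div_iff₀ (by positivity) (by exact_mod_cast hN1)]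
        have h1 : N + 1 ≤ 2 ^ ℓ := by omega
        have h2 : (N + 1) * (N + 1) * N ≤ 1 * 2 ^ (4 * ℓ) := by
          calc (N+1)*(N+1)*N ≤ 2^ℓ * 2^ℓ * 2^ℓ := by gcongr; omega
            _ = 2 ^ (3 * ℓ) := by ring
            _ ≤ 2 ^ (4 * ℓ) := Nat.pow_le_pow_right (by norm_num) (by omega)
            _ = _ := by ring
        exact_mod_cast h2

open Classical in
theorem bip (D : Finset G) (e0 : G) (he0 : e0 ∈ D) (d : ℕ) (hD : D.card = d) (J ℓ : ℕ) (hJ : d ≤ 2 ^ J)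
    (hJ2 : 2 ≤ J) (hℓ : 2 * Fintype.card G ≤ 2 ^ ℓ)
    (hbig : 1000000 * J ^ 2 * ℓ ≤ d)
    (hgen : AddSubgroup.closure ((fun e => e - e0) '' (D : Set G)) = ⊤) :
    ((Finset.univ.filter (fun c : Finset G × Finset G => ∀ x ∈ c.1, ∀ y ∈ c.2, y - x ∉ D)).card : ℝ)
      ≤ 2 ^ (Fintype.card G + 1) * (1 + 1 / Fintype.card G) := by
  set N := Fintype.card G with hN
  set D' := D.image (fun x => -x) with hD'
  have hmD' : ∀ x, x ∈ D' ↔ -x ∈ D := by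
    intro x; simp [hD', neg_eq_iff_eq_neg]
  have hgen' : AddSubgroup.closure ((fun e => e - (-e0)) '' (D' : Set G)) = ⊤ := by
    rw [eq_top_iff, ← hgen, AddSubgroup.closure_le]
    rintro _ ⟨e, he, rfl⟩
    have : -e - (-e0) ∈ AddSubgroup.closure ((fun e => e - (-e0)) '' (D' : Set G)) :=
      AddSubgroup.subset_closure ⟨-e, by simpa [hmD'] using he, rfl⟩
    have h2 := neg_mem this
    rw [show -(-e - -e0) = e - e0 by abel] at h2
    exact h2
  have hD'c : D'.card = d := by rw [hD', Finset.card_image_of_injective _ neg_injective, hD]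
  have T1 := T_bound D e0 he0 d hD J ℓ hJ hJ2 hℓ hbig hgen
  have T2 := T_bound D' (-e0) (by rw [hmD']; simpa using he0) d hD'c J ℓ hJ hJ2 hℓ hbig hgen'
  rw [← hN] at T1 T2
  set 𝒜 := Finset.univ.filter (fun P : Finset G => 2 * (clo (outD D) P).card ≤ N) with h𝒜
  set 𝒜' := Finset.univ.filter (fun P : Finset G => 2 * (clo (outD D') P).card ≤ N) with h𝒜'
  have hmn : ∀ (E P : Finset G) (y : G), y ∈ nbr (outD E) P ↔ ∃ x ∈ P, y - x ∈ E := by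
    intro E P y; simp [nbr, mem_outD]
  have hsub : Finset.univ.filter (fun c : Finset G × Finset G => ∀ x ∈ c.1, ∀ y ∈ c.2, y - x ∉ D) ⊆
      (𝒜.biUnion fun P => ((nbr (outD D) P)ᶜ).powerset.image (fun Q => (P, Q))) ∪
      (𝒜'.biUnion fun Q => ((nbr (outD D') Q)ᶜ).powerset.image (fun P => (P, Q))) := by
    rintro ⟨P, Q⟩ hPQ
    simp only [Finset.mem_filter, Finset.mem_univ, true_and] at hPQ
    rw [Finset.mem_union, Finset.mem_biUnion, Finset.mem_biUnion]
    by_cases hP : P ∈ 𝒜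
    · left
      refine ⟨P, hP, Finset.mem_image.2 ⟨Q, ?_, rfl⟩⟩
      rw [Finset.mem_powerset]
      intro y hy
      rw [Finset.mem_compl, hmn]
      rintro ⟨x, hx, h⟩
      exact hPQ x hx y hy h
    · right
      refine ⟨Q, ?_, Finset.mem_image.2 ⟨P, ?_, rfl⟩⟩
      · simp only [h𝒜, h𝒜', Finset.mem_filter, Finset.mem_univ, true_and] at hP ⊢
        have h1 : (clo (outD D') Q).card ≤ (nbr (outD D') Q).card := by
          rw [← nbr_clo]; exact card_le_nbr D' (-e0) (by rw [hmD']; simpa using he0) _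
        have h2 : nbr (outD D') Q ⊆ (clo (outD D) P)ᶜ := by
          intro x hx
          rw [hmn] at hx
          obtain ⟨y, hy, hxy⟩ := hx
          rw [Finset.mem_compl]
          intro hc
          have h3 : y ∈ nbr (outD D) (clo (outD D) P) := by
            rw [hmn]; refine ⟨x, hc, ?_⟩
            rw [hmD'] at hxy; simpa using hxy
          rw [nbr_clo, hmn] at h3
          obtain ⟨x', hx', h4⟩ := h3
          exact hPQ x' hx' y hy h4
        have h3 := Finset.card_le_card h2
        rw [Finset.card_compl, ← hN] at h3
        omega
      · rw [Finset.mem_powerset]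
        intro x hx
        rw [Finset.mem_compl, hmn]
        rintro ⟨y, hy, h⟩
        rw [hmD'] at h
        exact hPQ x hx y hy (by simpa using h)
  have h1 : (Finset.univ.filter (fun c : Finset G × Finset G => ∀ x ∈ c.1, ∀ y ∈ c.2, y - x ∉ D)).card ≤
      ∑ P ∈ 𝒜, 2 ^ (N - (nbr (outD D) P).card) + ∑ Q ∈ 𝒜', 2 ^ (N - (nbr (outD D') Q).card) := by
    refine (Finset.card_le_card hsub).trans ((Finset.card_union_le _ _).trans ?_)
    apply Nat.add_le_add
    · refine Finset.card_biUnion_le.trans (Finset.sum_le_sum fun P _ => ?_)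
      refine Finset.card_image_le.trans ?_
      rw [Finset.card_powerset, Finset.card_compl]
    · refine Finset.card_biUnion_le.trans (Finset.sum_le_sum fun P _ => ?_)
      refine Finset.card_image_le.trans ?_
      rw [Finset.card_powerset, Finset.card_compl]
  have h2 : ((Finset.univ.filter (fun c : Finset G × Finset G => ∀ x ∈ c.1, ∀ y ∈ c.2, y - x ∉ D)).card : ℝ) ≤
      ∑ P ∈ 𝒜, (2:ℝ) ^ (N - (nbr (outD D) P).card) + ∑ Q ∈ 𝒜', (2:ℝ) ^ (N - (nbr (outD D') Q).card) := by
    exact_mod_cast h1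
  rw [pow_succ]
  linarith

end bip

lemma prop_sd {a b u a' b' u' : Prop}
    (h : ((a ∧ b) ∨ (¬ (a ↔ b) ∧ ¬ (a ↔ u)) ↔ (a' ∧ b') ∨ (¬ (a' ↔ b') ∧ ¬ (a' ↔ u'))) ∧
      ((a ∧ b) ∨ (¬ (a ↔ b) ∧ (a ↔ u)) ↔ (a' ∧ b') ∨ (¬ (a' ↔ b') ∧ (a' ↔ u')))) :
    ¬ (a ↔ b) ↔ ¬ (a' ↔ b') := by
  by_cases a <;> by_cases b <;> by_cases u <;> by_cases a' <;> by_cases b' <;> by_cases u' <;> simp_all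

lemma prop_eq {a b u a' b' : Prop}
    (h : ((a ∧ b) ∨ (¬ (a ↔ b) ∧ ¬ (a ↔ u)) ↔ (a' ∧ b') ∨ (¬ (a' ↔ b') ∧ ¬ (a' ↔ u))) ∧
      ((a ∧ b) ∨ (¬ (a ↔ b) ∧ (a ↔ u)) ↔ (a' ∧ b') ∨ (¬ (a' ↔ b') ∧ (a' ↔ u)))) :
    (a ↔ a') ∧ (b ↔ b') := by
  by_cases a <;> by_cases b <;> by_cases u <;> by_cases a' <;> by_cases b' <;> simp_all

section red
variable {G : Type} [AddCommGroup G] [Fintype G] [DecidableEq G]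

def indF (D : Finset G) : Finset (Finset G) :=
  Finset.univ.filter (fun I : Finset G => ∀ u ∈ I, ∀ v ∈ I, v - u ∉ D)

def pairF (D : Finset G) : Finset (Finset G × Finset G) :=
  Finset.univ.filter (fun c : Finset G × Finset G => ∀ x ∈ c.1, ∀ y ∈ c.2, y - x ∉ D)

lemma mem_indF (D I : Finset G) : I ∈ indF D ↔ ∀ u ∈ I, ∀ v ∈ I, v - u ∉ D := by simp [indF]

lemma swap_ineq (D : Finset G) (hs : ∀ x ∈ D, -x ∈ D) : (indF D).card ^ 2 ≤ (pairF D).card := by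
  classical
  have hU : ∀ S : Finset G, ∃ U : Finset G, (∃ V ⊆ S, V ∈ indF D ∧ S \ V ∈ indF D) → U ⊆ S ∧ U ∈ indF D ∧ S \ U ∈ indF D := by
    intro S
    by_cases h : ∃ V ⊆ S, V ∈ indF D ∧ S \ V ∈ indF D
    · obtain ⟨V, h1, h2⟩ := h
      exact ⟨V, fun _ => ⟨h1, h2⟩⟩
    · exact ⟨∅, fun h' => absurd h' h⟩
  choose U hU using hU
  rw [pow_two, ← Finset.card_product]
  set sd : Finset G → Finset G → Finset G := fun I J => Finset.univ.filter (fun x => ¬ (x ∈ I ↔ x ∈ J)) with hsd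
  have msd : ∀ I J x, x ∈ sd I J ↔ ¬ (x ∈ I ↔ x ∈ J) := by intro I J x; simp [hsd]
  -- P: x in both, or in the symmetric difference with x ∈ I xor x ∈ U
  set P : Finset G × Finset G → Finset G := fun c => Finset.univ.filter (fun x =>
    (x ∈ c.1 ∧ x ∈ c.2) ∨ (¬ (x ∈ c.1 ↔ x ∈ c.2) ∧ ¬ (x ∈ c.1 ↔ x ∈ U (sd c.1 c.2)))) with hP
  set Q : Finset G × Finset G → Finset G := fun c => Finset.univ.filter (fun x =>
    (x ∈ c.1 ∧ x ∈ c.2) ∨ (¬ (x ∈ c.1 ↔ x ∈ c.2) ∧ (x ∈ c.1 ↔ x ∈ U (sd c.1 c.2)))) with hQ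
  have mP : ∀ c x, x ∈ P c ↔ (x ∈ c.1 ∧ x ∈ c.2) ∨ (¬ (x ∈ c.1 ↔ x ∈ c.2) ∧ ¬ (x ∈ c.1 ↔ x ∈ U (sd c.1 c.2))) := by
    intro c x; simp only [hP, Finset.mem_filter, Finset.mem_univ, true_and]
  have mQ : ∀ c x, x ∈ Q c ↔ (x ∈ c.1 ∧ x ∈ c.2) ∨ (¬ (x ∈ c.1 ↔ x ∈ c.2) ∧ (x ∈ c.1 ↔ x ∈ U (sd c.1 c.2))) := by
    intro c x; simp only [hQ, Finset.mem_filter, Finset.mem_univ, true_and]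
  apply Finset.card_le_card_of_injOn (fun c => (P c, Q c))
  · rintro ⟨I, J⟩ hIJ
    rw [Finset.mem_coe, Finset.mem_product] at hIJ
    obtain ⟨hI, hJ⟩ := hIJ
    simp only at hI hJ
    have hUS := hU (sd I J) ⟨I \ J, by
        intro x; rw [msd, Finset.mem_sdiff]; tauto, by
        rw [mem_indF] at hI ⊢
        intro u hu v hv
        exact hI u (Finset.mem_sdiff.1 hu).1 v (Finset.mem_sdiff.1 hv).1, by
        rw [mem_indF] at hJ ⊢
        intro u hu v hv
        rw [Finset.mem_sdiff, msd, Finset.mem_sdiff] at hu hv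
        exact hJ u (by tauto) v (by tauto)⟩
    obtain ⟨h1, h2, h3⟩ := hUS
    rw [mem_indF] at hI hJ h2 h3
    rw [Finset.mem_coe, pairF, Finset.mem_filter]
    refine ⟨Finset.mem_univ _, ?_⟩
    intro x hx y hy
    rw [mP] at hx
    rw [mQ] at hy
    simp only at hx hy
    rcases hx with hx | hx
    · rcases hy with hy | hy
      · exact hI x hx.1 y hy.1
      · by_cases hyI : y ∈ I
        · exact hI x hx.1 y hyI
        · exact hJ x hx.2 y (by tauto)
    · rcases hy with hy | hy
      · by_cases hxI : x ∈ I
        · exact hI x hxI y hy.1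
        · exact hJ x (by tauto) y hy.2
      · intro hD
        have e1 : ¬ (x ∈ I ↔ y ∈ I) := by
          intro h
          by_cases hxI : x ∈ I
          · exact hI x hxI y (h.1 hxI) hD
          · exact hJ x (by tauto) y (by tauto) hD
        have e2 : ¬ (x ∈ U (sd I J) ↔ y ∈ U (sd I J)) := by
          intro h
          by_cases hxI : x ∈ U (sd I J)
          · exact h2 x hxI y (h.1 hxI) hD
          · refine h3 x ?_ y ?_ hD
            · rw [Finset.mem_sdiff, msd]; tauto
            · rw [Finset.mem_sdiff, msd]; tauto
        tauto
  · rintro ⟨I, J⟩ _ ⟨I', J'⟩ _ h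
    simp only [Prod.mk.injEq] at h
    obtain ⟨hPP, hQQ⟩ := h
    have hx : ∀ x, (x ∈ P (I, J) ↔ x ∈ P (I', J')) ∧ (x ∈ Q (I, J) ↔ x ∈ Q (I', J')) := by
      intro x; rw [hPP, hQQ]; exact ⟨Iff.rfl, Iff.rfl⟩
    simp only [mP, mQ] at hx
    have hS : sd I J = sd I' J' := by
      ext x
      rw [msd, msd]
      exact prop_sd (hx x)
    rw [hS] at hx
    rw [Prod.mk.injEq]
    constructor
    · ext x
      exact (prop_eq (hx x)).1
    · ext x
      exact (prop_eq (hx x)).2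

lemma case_top (D : Finset G) (hs : ∀ x ∈ D, -x ∈ D) (e0 : G) (he0 : e0 ∈ D) (d : ℕ) (hD : D.card = d) (J ℓ n : ℕ)
    (hn : Fintype.card G = 2 * n) (hJ : d ≤ 2 ^ J) (hJ2 : 2 ≤ J) (hℓ : 4 * n ≤ 2 ^ ℓ)
    (hbig : 1000000 * J ^ 2 * ℓ ≤ d)
    (hgen : AddSubgroup.closure ((fun e => e - e0) '' (D : Set G)) = ⊤) :
    ((indF D).card : ℝ) ≤ 2 ^ (n + 1) := by
  have hn1 : 0 < Fintype.card G := Fintype.card_pos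
  have h1 := bip D e0 he0 d hD J ℓ hJ hJ2 (by omega) hbig hgen
  have h2 : ((indF D).card : ℝ) ^ 2 ≤ (pairF D).card := by exact_mod_cast swap_ineq D hs
  have h3 : ((pairF D).card : ℝ) ≤ 2 ^ (Fintype.card G + 1) * (1 + 1 / Fintype.card G) := by
    refine le_trans (le_of_eq ?_) h1
    congr 2
  have h4 : (1:ℝ) / Fintype.card G ≤ 1 := by
    rw [div_le_one (by exact_mod_cast hn1)]; exact_mod_cast hn1
  have h5 : (2:ℝ) ^ (Fintype.card G + 1) * (1 + 1 / Fintype.card G) ≤ (2 ^ (n + 1)) ^ 2 := by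
    calc _ ≤ (2:ℝ) ^ (Fintype.card G + 1) * 2 := by gcongr; linarith
      _ = _ := by rw [hn]; ring
  exact (pow_le_pow_iff_left₀ (by positivity) (by positivity) (two_ne_zero)).1 (h2.trans (h3.trans h5))
lemma case_bip (D : Finset G) (hs : ∀ x ∈ D, -x ∈ D) (hgD : AddSubgroup.closure (D : Set G) = ⊤)
    (e0 : G) (he0 : e0 ∈ D) (d : ℕ) (hD : D.card = d) (J ℓ n : ℕ)
    (hn : Fintype.card G = 2 * n) (hJ : d ≤ 2 ^ J) (hJ2 : 2 ≤ J) (hℓ : 4 * n ≤ 2 ^ ℓ)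
    (hbig : 1000000 * J ^ 2 * ℓ ≤ d)
    (hgen : AddSubgroup.closure ((fun e => e - e0) '' (D : Set G)) ≠ ⊤) :
    ((indF D).card : ℝ) ≤ 2 ^ (n + 1) * (1 + 1 / n) := by
  classical
  set k : Set G := (fun e => e - e0) '' (D : Set G) with hk
  set H := AddSubgroup.closure k with hH
  have hDH : ∀ e ∈ D, e - e0 ∈ H := fun e he => AddSubgroup.subset_closure ⟨e, he, rfl⟩
  have h2e : e0 + e0 ∈ H := by
    have := neg_mem (hDH _ (hs _ he0))
    rwa [show -(-e0 - e0) = e0 + e0 by abel] at this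
  have hcov : ∀ x : G, x ∈ H ∨ x - e0 ∈ H := by
    intro x
    have hx : x ∈ AddSubgroup.closure (D : Set G) := by rw [hgD]; trivial
    induction hx using AddSubgroup.closure_induction with
    | mem y hy => right; exact hDH y hy
    | zero => left; exact zero_mem _
    | add y z _ _ h1 h2 =>
      rcases h1 with h1 | h1 <;> rcases h2 with h2 | h2
      · left; exact add_mem h1 h2
      · right; rw [add_sub_assoc]; exact add_mem h1 h2
      · right; rw [show y + z - e0 = (y - e0) + z by abel]; exact add_mem h1 h2
      · left; rw [show y + z = (y - e0) + (z - e0) + (e0 + e0) by abel]; exact add_mem (add_mem h1 h2) h2e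
    | neg y _ h =>
      rcases h with h | h
      · left; exact neg_mem h
      · right; rw [show -y - e0 = -(y - e0) - (e0 + e0) by abel]; exact sub_mem (neg_mem h) h2e
  have he0H : e0 ∉ H := by
    intro h
    apply hgen
    rw [eq_top_iff, ← hgD, AddSubgroup.closure_le]
    intro e he
    have := add_mem (hDH e he) h
    simpa using this
  have hcard : Fintype.card H = n := by
    have h1 : (Finset.univ : Finset G) = cst H 0 ∪ cst H e0 := by
      ext x; simp only [Finset.mem_univ, Finset.mem_union, mem_cst, sub_zero, true_iff]; exact hcov x
    have h2 : Disjoint (cst H 0) (cst H e0) := by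
      rw [Finset.disjoint_left]
      intro x h1 h2
      rw [mem_cst, sub_zero] at h1
      rw [mem_cst] at h2
      apply he0H
      have := sub_mem h1 h2
      simpa using this
    have h3 : Fintype.card G = (cst H 0 ∪ cst H e0).card := by rw [← h1, Finset.card_univ]
    rw [Finset.card_union_of_disjoint h2, cst_card, cst_card, Nat.card_eq_fintype_card] at h3
    omega
  set D1 : Finset H := Finset.univ.filter (fun h => (h:G) + e0 ∈ D) with hD1
  have mD1 : ∀ h : H, h ∈ D1 ↔ (h:G) + e0 ∈ D := by intro h; simp [hD1]
  have hD1c : D1.card = d := by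
    rw [← hD]
    apply Finset.card_bij (fun (h : H) _ => (h:G) + e0)
    · intro h hh; exact (mD1 h).1 hh
    · intro a _ b _ h; simpa using h
    · intro e he
      exact ⟨⟨e - e0, hDH e he⟩, by rw [mD1]; simpa using he, by simp⟩
  have hg1 : AddSubgroup.closure ((fun e => e - 0) '' (D1 : Set H)) = ⊤ := by
    have h1 : (fun e : H => e - 0) '' (D1 : Set H) = ((↑) : H → G) ⁻¹' k := by
      ext x
      simp only [sub_zero, Set.image_id', Finset.mem_coe, mD1, Set.mem_preimage, hk, Set.mem_image]
      constructor
      · intro h; exact ⟨_, h, by simp⟩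
      · rintro ⟨e, he, h⟩; rw [← h]; simpa using he
    rw [h1]
    exact AddSubgroup.closure_closure_coe_preimage
  have hb := bip D1 0 (by rw [mD1]; simpa using he0) d hD1c J ℓ hJ hJ2 (by rw [hcard]; omega) hbig hg1
  rw [hcard] at hb
  refine le_trans ?_ hb
  norm_cast
  apply Finset.card_le_card_of_injOn (fun I => (Finset.univ.filter (fun h : H => (h:G) ∈ I),
    Finset.univ.filter (fun h : H => (h:G) + e0 ∈ I)))
  · intro I hI
    rw [Finset.mem_coe, mem_indF] at hI
    simp only [Finset.coe_filter, Set.mem_setOf_eq, Finset.mem_univ, true_and, Finset.mem_filter]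
    intro x hx y hy hd
    rw [mD1] at hd
    apply hI _ hx _ hy
    rwa [show (y:G) + e0 - x = ((y - x : H) : G) + e0 by push_cast; abel]
  · intro I _ I' _ h
    simp only [Prod.mk.injEq] at h
    obtain ⟨h1, h2⟩ := h
    ext x
    rcases hcov x with hx | hx
    · have : (⟨x, hx⟩ : H) ∈ Finset.univ.filter (fun h : H => (h:G) ∈ I) ↔ (⟨x, hx⟩ : H) ∈ Finset.univ.filter (fun h : H => (h:G) ∈ I') := by rw [h1]
      simpa using this
    · have : (⟨x - e0, hx⟩ : H) ∈ Finset.univ.filter (fun h : H => (h:G) + e0 ∈ I) ↔ (⟨x - e0, hx⟩ : H) ∈ Finset.univ.filter (fun h : H => (h:G) + e0 ∈ I') := by rw [h2]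
      simpa using this

end red

lemma numInd_eq {F : Type} [AddCommGroup F] [Fintype F] [DecidableEq F] (D : Set F) (D' : Finset F)
    (hDD : ∀ x, x ∈ D' ↔ x ∈ D) (hs : ∀ x ∈ D, -x ∈ D) (h0 : (0 : F) ∉ D) :
    numIndSets (cayleyGraph D) = (indF D').card := by
  classical
  have hadj : ∀ u v : F, (cayleyGraph D).Adj u v ↔ v - u ∈ D := by
    intro u v
    simp only [cayleyGraph, SimpleGraph.fromRel_adj]
    constructor
    · rintro ⟨_, h | h⟩
      · exact h
      · simpa using hs _ h
    · intro h
      refine ⟨?_, Or.inl h⟩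
      rintro rfl
      apply h0
      simpa using h
  unfold numIndSets
  rw [← Nat.card_eq_finsetCard]
  refine Nat.card_congr ⟨fun s => ⟨Finset.univ.filter (fun x => x ∈ s.1), ?_⟩,
    fun I => ⟨(I.1 : Set F), ?_⟩, ?_, ?_⟩
  · rw [mem_indF]
    intro u hu v hv h
    simp only [Finset.mem_filter, Finset.mem_univ, true_and] at hu hv
    exact s.2 hu hv ((hadj u v).2 ((hDD _).1 h))
  · intro u v hu hv h
    exact (mem_indF D' I.1).1 I.2 u hu v hv ((hDD _).2 ((hadj u v).1 h))
  · intro s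
    apply Subtype.ext
    ext x
    simp
  · intro I
    apply Subtype.ext
    ext x
    simp

lemma two_le_d {F : Type} [AddCommGroup F] [Fintype F] (D' : Finset F) (hc : 4 ≤ Fintype.card F)
    (hs : ∀ x ∈ D', -x ∈ D') (hg : AddSubgroup.closure (D' : Set F) = ⊤) : 2 ≤ D'.card := by
  by_contra hlt
  have hle : D'.card ≤ 1 := by omega
  have hx : ∃ x : F, -x = x ∧ (D' : Set F) ⊆ {x} := by
    rcases D'.eq_empty_or_nonempty with h | ⟨x, hx⟩
    · exact ⟨0, by simp, by simp [h]⟩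
    · have := Finset.card_le_one.1 hle
      exact ⟨x, this _ (hs x hx) _ hx, fun y hy => this _ hy _ hx⟩
  obtain ⟨x, hx, hsub⟩ := hx
  have htop : AddSubgroup.zmultiples x = ⊤ := by
    rw [eq_top_iff, ← hg, AddSubgroup.closure_le]
    intro y hy
    rw [hsub hy]
    exact AddSubgroup.mem_zmultiples x
  have h2 : addOrderOf x ∣ 2 := by
    rw [addOrderOf_dvd_iff_nsmul_eq_zero, two_nsmul]
    nth_rewrite 1 [← hx]
    simp
  have h3 : Nat.card (AddSubgroup.zmultiples x) = addOrderOf x := Nat.card_zmultiples x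
  rw [htop, AddSubgroup.card_top, Nat.card_eq_fintype_card] at h3
  have := Nat.le_of_dvd (by norm_num) h2
  omega

lemma clog_le_logb (m : ℕ) (hm : 1 < m) : (Nat.clog 2 m : ℝ) ≤ logb 2 m + 1 := by
  have h1 : 2 ^ (Nat.clog 2 m - 1) < m := Nat.pow_pred_clog_lt_self (by norm_num) hm
  have h2 : 0 < Nat.clog 2 m := Nat.clog_pos (by norm_num) hm
  have h3 : ((Nat.clog 2 m - 1 : ℕ) : ℝ) ≤ logb 2 m := by
    rw [Real.le_logb_iff_rpow_le (by norm_num) (by positivity), Real.rpow_natCast]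
    exact_mod_cast h1.le
  rw [Nat.cast_sub h2] at h3
  push_cast at h3
  linarith

lemma params (d n : ℕ) (hd : 2 ≤ d) (hn : 2 ≤ n)
    (h : (16000000 : ℝ) * (logb 2 d) ^ (8 : ℕ) * logb 2 n ≤ (d : ℝ)) :
    ∃ J ℓ : ℕ, d ≤ 2 ^ J ∧ 2 ≤ J ∧ 4 * n ≤ 2 ^ ℓ ∧ 1000000 * J ^ 2 * ℓ ≤ d := by
  have hL : 1 ≤ logb 2 d := by
    rw [Real.le_logb_iff_rpow_le (by norm_num) (by positivity), Real.rpow_one]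
    exact_mod_cast hd
  have hN : 1 ≤ logb 2 n := by
    rw [Real.le_logb_iff_rpow_le (by norm_num) (by positivity), Real.rpow_one]
    exact_mod_cast hn
  have h28 : (logb 2 d) ^ 2 ≤ (logb 2 d) ^ 8 := pow_le_pow_right₀ hL (by norm_num)
  have h8 : 1 ≤ (logb 2 d) ^ 8 := one_le_pow₀ hL
  have hd3 : 3 ≤ d := by
    have : (3:ℝ) ≤ d := by nlinarith
    exact_mod_cast this
  refine ⟨Nat.clog 2 d, Nat.clog 2 (4 * n), Nat.le_pow_clog (by norm_num) _, ?_,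
    Nat.le_pow_clog (by norm_num) _, ?_⟩
  · by_contra hlt
    have h1 := Nat.le_pow_clog (b := 2) (by norm_num) d
    have h2 : 2 ^ Nat.clog 2 d ≤ 2 ^ 1 := Nat.pow_le_pow_right (by norm_num) (by omega)
    omega
  · have h1 := clog_le_logb d (by omega)
    have h2 := clog_le_logb (4 * n) (by omega)
    have h3 : logb 2 ((4 * n : ℕ) : ℝ) = 2 + logb 2 n := by
      push_cast
      rw [Real.logb_mul (by norm_num) (by positivity), show (4:ℝ) = 2 ^ (2:ℕ) by norm_num, Real.logb_pow]
      simp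
    rw [h3] at h2
    have hJ : (Nat.clog 2 d : ℝ) ≤ 2 * logb 2 d := by linarith
    have hl : (Nat.clog 2 (4 * n) : ℝ) ≤ 4 * logb 2 n := by linarith
    have : (1000000 : ℝ) * (Nat.clog 2 d : ℝ) ^ 2 * (Nat.clog 2 (4 * n) : ℝ) ≤ d := by
      calc _ ≤ (1000000 : ℝ) * (2 * logb 2 d) ^ 2 * (4 * logb 2 n) := by gcongr
        _ = 16000000 * (logb 2 d) ^ 2 * logb 2 n := by ring
        _ ≤ 16000000 * (logb 2 d) ^ 8 * logb 2 n := by gcongr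
        _ ≤ d := h
    exact_mod_cast this

theorem stmt1 :
    ∃ C : ℝ, 0 < C ∧ ∀ ε : ℝ, 0 < ε → ∃ n₀ : ℕ, ∀ n : ℕ, n₀ ≤ n →
      ∀ (F : Type) [AddCommGroup F] [Fintype F],
        Fintype.card F = 2 * n →
        ∀ D : Set F, (∀ x ∈ D, -x ∈ D) → (0 : F) ∉ D →
          AddSubgroup.closure D = ⊤ →
          (cayleyGraph D).Connected →
          ∀ d : ℕ, D.ncard = d →
            C * (logb 2 d) ^ (8 : ℕ) * logb 2 n ≤ (d : ℝ) →
            (d : ℝ) ≤ (n : ℝ) ^ ((1 : ℝ) / 3) →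
            (d : ℝ) * (logb 2 d) ^ (3 : ℕ) ≤ ((D + D).ncard : ℝ) →
            (numIndSets (cayleyGraph D) : ℝ) ≤ (1 + ε) * 2 ^ (n + 1) := by
  refine ⟨16000000, by norm_num, fun ε hε => ⟨max 2 ⌈1 / ε⌉₊, ?_⟩⟩
  intro n hn F _ _ hF D hs h0 hg _ d hd hC _ _
  classical
  have hn2 : 2 ≤ n := le_trans (le_max_left _ _) hn
  have hnε : 1 / ε ≤ n := (Nat.le_ceil _).trans (by exact_mod_cast le_trans (le_max_right _ _) hn)
  have hnε' : 1 / (n:ℝ) ≤ ε := by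
    rw [div_le_iff₀ hε] at hnε
    rw [div_le_iff₀ (by positivity)]
    linarith
  obtain ⟨D', rfl⟩ : ∃ D' : Finset F, (D' : Set F) = D := ⟨D.toFinset, by simp⟩
  rw [Set.ncard_coe_finset] at hd
  have hs' : ∀ x ∈ D', -x ∈ D' := fun x hx => by simpa using hs x (by simpa using hx)
  have hd2 : 2 ≤ d := hd ▸ two_le_d D' (by omega) hs' hg
  obtain ⟨J, ℓ, hJ, hJ2, hℓ, hbig⟩ := params d n hd2 hn2 hC
  obtain ⟨e0, he0⟩ : D'.Nonempty := Finset.card_pos.1 (by omega)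
  rw [numInd_eq (D' : Set F) D' (by simp) hs h0]
  by_cases hgen : AddSubgroup.closure ((fun e => e - e0) '' (D' : Set F)) = ⊤
  · refine (case_top D' hs' e0 he0 d hd J ℓ n hF hJ hJ2 hℓ hbig hgen).trans ?_
    have : (0:ℝ) < 2 ^ (n + 1) := by positivity
    nlinarith
  · refine (case_bip D' hs' hg e0 he0 d hd J ℓ n hF hJ hJ2 hℓ hbig hgen).trans ?_
    rw [mul_comm]
    gcongr
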